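/- Let U, V be domains in ℝ², each different from ℝ², and let f : ∂_H U → ∂_H V be an isometry of the Hausdorff boundaries in the relative metrics. Let Δ(x,y,z) be a boundary triangle for U, and let x', y', z' be the supports of the f-images of the elements of ∂_H U generated by x, y, z via the boundary intervals ]x,y[, ]y,z[, ]x,z[. Then Δ(x',y',z') is a boundary triangle for V, and |x' − y'| = |x − y|, |z' − y'| = |z − y|, |x' − z'| = |x − z|. -/

import Mathlib

open Set Metric Filter

noncomputable section

/-- Euclidean `n`-space. -/
abbrev Euc (n : ℕ) := EuclideanSpace ℝ (Fin n)

/-- A domain: a nonempty open connected subset of Euclidean space. -/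
def IsEucDomain {n : ℕ} (U : Set (Euc n)) : Prop := IsOpen U ∧ IsConnected U

/-- Intrinsic extended distance inside `S`: the infimum of the lengths (total
variations) of continuous paths joining `x` and `y` within `S`. -/
def intrinsicDist {n : ℕ} (S : Set (Euc n)) (x y : Euc n) : ENNReal :=
  ⨅ (γ : ℝ → Euc n) (_ : ContinuousOn γ (Icc (0:ℝ) 1)) (_ : γ 0 = x) (_ : γ 1 = y)
    (_ : MapsTo γ (Icc (0:ℝ) 1) S), eVariationOn γ (Icc (0:ℝ) 1)

/-- A Cauchy sequence (in the intrinsic metric) of points of `U` that does not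
converge (in the intrinsic metric) to a point of `U`; such sequences represent
elements of the Hausdorff boundary of `U`. -/
structure HBSeq {n : ℕ} (U : Set (Euc n)) where
  seq : ℕ → Euc n
  mem : ∀ k, seq k ∈ U
  cauchy : ∀ ε : ENNReal, 0 < ε → ∃ N : ℕ, ∀ j ≥ N, ∀ k ≥ N,
    intrinsicDist U (seq j) (seq k) < ε
  notConv : ¬ ∃ u ∈ U, Tendsto (fun k => intrinsicDist U (seq k) u) atTop (nhds 0)

/-- Two Cauchy sequences represent the same Hausdorff-boundary element iff the
intrinsic distance between corresponding terms tends to `0`. -/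
def HBEquiv {n : ℕ} (U : Set (Euc n)) (s t : HBSeq U) : Prop :=
  Tendsto (fun k => intrinsicDist U (s.seq k) (t.seq k)) atTop (nhds 0)

/-- The Hausdorff boundary of `U`: points of the completion of `(U, ρ_U)` not
corresponding to points of `U`. -/
def HausdorffBoundary {n : ℕ} (U : Set (Euc n)) : Type := Quot (HBEquiv U)

/-- The relative metric on the Hausdorff boundary (the completion metric). -/
def hbDist {n : ℕ} {U : Set (Euc n)} (a b : HausdorffBoundary U) : ENNReal :=
  limsup (fun k => intrinsicDist U ((Quot.out a).seq k) ((Quot.out b).seq k)) atTop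

/-- The support of a Hausdorff-boundary element: the Euclidean limit of a
representing Cauchy sequence. -/
def hbSupport {n : ℕ} {U : Set (Euc n)} (a : HausdorffBoundary U) : Euc n :=
  limUnder atTop (Quot.out a).seq

/-- A (bijective) isometry of Hausdorff boundaries in the relative metrics. -/
def IsHBIsometry {n : ℕ} {U V : Set (Euc n)}
    (f : HausdorffBoundary U → HausdorffBoundary V) : Prop :=
  Function.Bijective f ∧ ∀ a b : HausdorffBoundary U, hbDist (f a) (f b) = hbDist a b

/-- `U` is uniquely determined in the class `𝒰` by the relative metric of its
Hausdorff boundary: any member of `𝒰` with Hausdorff boundary isometric (in the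
relative metrics) to that of `U` is the image of `U` under a Euclidean isometry. -/
def UniquelyDeterminedIn {n : ℕ} (𝒰 : Set (Set (Euc n))) (U : Set (Euc n)) : Prop :=
  ∀ V ∈ 𝒰, (∃ f : HausdorffBoundary U → HausdorffBoundary V, IsHBIsometry f) →
    ∃ J : Euc n ≃ᵢ Euc n, J '' U = V

/-- `]x,y[` is a boundary interval for `U`. -/
def IsBoundaryInterval {n : ℕ} (U : Set (Euc n)) (x y : Euc n) : Prop :=
  x ≠ y ∧ x ∈ frontier U ∧ y ∈ frontier U ∧ openSegment ℝ x y ⊆ U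

/-- The Hausdorff-boundary element `a` is generated by the boundary interval
`]x,y[` at its endpoint `x`: it is represented by a Cauchy sequence of points of
`]x,y[` converging (in the Euclidean metric) to `x`. -/
def GeneratesEndpoint {n : ℕ} (U : Set (Euc n)) (x y : Euc n)
    (a : HausdorffBoundary U) : Prop :=
  ∃ s : HBSeq U, Quot.mk (HBEquiv U) s = a ∧ (∀ k, s.seq k ∈ openSegment ℝ x y) ∧
    Tendsto s.seq atTop (nhds x)

/-- `Δ(x,y,z)` is a boundary triangle for `U`. -/
def IsBoundaryTriangle (U : Set (Euc 2)) (x y z : Euc 2) : Prop :=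
  ¬ Collinear ℝ ({x, y, z} : Set (Euc 2)) ∧
    x ∈ frontier U ∧ y ∈ frontier U ∧ z ∈ frontier U ∧
    convexHull ℝ ({x, y, z} : Set (Euc 2)) \ {x, y, z} ⊆ U

theorem intrinsicDist_le_of_path {n : ℕ} {S : Set (Euc n)} {a b : ℝ} (hab : a ≤ b)
    {γ : ℝ → Euc n} (hγ : ContinuousOn γ (Icc a b)) (hm : MapsTo γ (Icc a b) S) :
    intrinsicDist S (γ a) (γ b) ≤ eVariationOn γ (Icc a b) := by
  set φ : ℝ → ℝ := fun t => a + t * (b - a) with hφ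
  have hmono : MonotoneOn φ (Icc 0 1) := by
    intro s _ t _ hst
    have := mul_le_mul_of_nonneg_right hst (sub_nonneg.2 hab)
    simp only [hφ]; linarith
  have hmaps : MapsTo φ (Icc 0 1) (Icc a b) := by
    intro t ht
    have h0 := mul_nonneg ht.1 (sub_nonneg.2 hab)
    have h1 := mul_le_mul_of_nonneg_right ht.2 (sub_nonneg.2 hab)
    constructor <;> simp only [hφ] <;> linarith
  have hc : Continuous φ := by fun_prop
  refine le_trans ?_ (eVariationOn.comp_le_of_monotoneOn γ φ hmono hmaps)
  refine iInf_le_of_le (γ ∘ φ) (iInf_le_of_le (hγ.comp hc.continuousOn hmaps)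
    (iInf_le_of_le ?_ (iInf_le_of_le ?_ (iInf_le_of_le (hm.comp hmaps) le_rfl))))
  · simp [hφ]
  · simp [hφ]

theorem edist_le_intrinsicDist {n : ℕ} (S : Set (Euc n)) (x y : Euc n) :
    edist x y ≤ intrinsicDist S x y := by
  refine le_iInf fun γ => le_iInf fun _ => le_iInf fun h0 => le_iInf fun h1 => le_iInf fun _ => ?_
  rw [← h0, ← h1]
  exact eVariationOn.edist_le γ (by simp) (by simp)

theorem intrinsicDist_le_of_segment {n : ℕ} {S : Set (Euc n)} {x y : Euc n}
    (h : segment ℝ x y ⊆ S) : intrinsicDist S x y ≤ edist x y := by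
  set L : ℝ → Euc n := fun t => AffineMap.lineMap x y t with hL
  have hc : ContinuousOn L (Icc 0 1) := by
    have : Continuous L := AffineMap.lineMap_continuous
    exact this.continuousOn
  have hm : MapsTo L (Icc 0 1) S := by
    intro t ht
    apply h
    rw [segment_eq_image_lineMap]
    exact ⟨t, ht, rfl⟩
  have h1 := intrinsicDist_le_of_path zero_le_one hc hm
  have hl : LipschitzOnWith (nndist x y) L univ :=
    (lipschitzWith_lineMap x y).lipschitzOnWith
  have h2 := hl.comp_eVariationOn_le (g := id) (s := Icc (0:ℝ) 1) (mapsTo_univ _ _)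
  have h3 : eVariationOn (id : ℝ → ℝ) (Icc 0 1) = 1 := by
    simp
  have e0 : L 0 = x := by simp [hL]
  have e1 : L 1 = y := by simp [hL]
  rw [e0, e1] at h1
  rw [h3, mul_one, ← edist_nndist] at h2
  exact h1.trans h2

theorem intrinsicDist_comm {n : ℕ} (S : Set (Euc n)) (x y : Euc n) :
    intrinsicDist S x y = intrinsicDist S y x := by
  suffices H : ∀ x y, intrinsicDist S x y ≤ intrinsicDist S y x from le_antisymm (H _ _) (H _ _)
  intro x y
  refine le_iInf fun γ => le_iInf fun hc => le_iInf fun h0 => le_iInf fun h1 => le_iInf fun hm => ?_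
  set φ : ℝ → ℝ := fun t => 1 - t
  have hmaps : MapsTo φ (Icc 0 1) (Icc 0 1) := fun t ht => ⟨by simp [φ, ht.2], by simp [φ, ht.1]⟩
  have hanti : AntitoneOn φ (Icc 0 1) := fun s _ t _ hst => by simp only [φ]; linarith
  refine le_trans ?_ (eVariationOn.comp_le_of_antitoneOn γ φ hanti hmaps)
  refine iInf_le_of_le (γ ∘ φ) (iInf_le_of_le (hc.comp (by fun_prop) hmaps)
    (iInf_le_of_le ?_ (iInf_le_of_le ?_ (iInf_le_of_le (hm.comp hmaps) le_rfl))))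
  · simp [φ, h1]
  · simp [φ, h0]

theorem intrinsicDist_triangle {n : ℕ} (S : Set (Euc n)) (x y z : Euc n) :
    intrinsicDist S x z ≤ intrinsicDist S x y + intrinsicDist S y z := by
  refine ENNReal.le_of_forall_pos_le_add fun ε hε hfin => ?_
  have hε2 : (0 : ENNReal) < ε / 2 := by simpa using hε.ne'
  have hx : intrinsicDist S x y < intrinsicDist S x y + ε / 2 :=
    ENNReal.lt_add_right (ne_top_of_le_ne_top hfin.ne le_self_add) hε2.ne'
  have hy : intrinsicDist S y z < intrinsicDist S y z + ε / 2 :=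
    ENNReal.lt_add_right (ne_top_of_le_ne_top hfin.ne le_add_self) hε2.ne'
  conv_lhs at hx => rw [intrinsicDist]
  conv_lhs at hy => rw [intrinsicDist]
  simp only [iInf_lt_iff] at hx hy
  obtain ⟨γ, hc, h0, h1, hm, hl⟩ := hx
  obtain ⟨δ, hc', h0', h1', hm', hl'⟩ := hy
  set η : ℝ → Euc n := fun t => if t ≤ 1 then γ t else δ (t - 1) with hη
  have e1 : EqOn η γ (Icc 0 1) := fun t ht => by simp [hη, ht.2]
  have e2 : EqOn η (δ ∘ fun t => t - 1) (Icc 1 2) := by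
    intro t ht
    rcases eq_or_lt_of_le ht.1 with h | h
    · subst h; simp [hη, h1, h0']
    · simp [hη, not_le.2 h]
  have hmaps : MapsTo (fun t : ℝ => t - 1) (Icc 1 2) (Icc 0 1) := by
    intro t ht; constructor <;> simp <;> linarith [ht.1, ht.2]
  have c1 : ContinuousOn η (Icc 0 1) := hc.congr e1
  have c2 : ContinuousOn η (Icc 1 2) := (hc'.comp (by fun_prop) hmaps).congr e2
  have hun : Icc (0:ℝ) 1 ∪ Icc 1 2 = Icc 0 2 := Icc_union_Icc_eq_Icc (by norm_num) (by norm_num)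
  have c : ContinuousOn η (Icc 0 2) := by
    rw [← hun]; exact c1.union_of_isClosed c2 isClosed_Icc isClosed_Icc
  have m : MapsTo η (Icc 0 2) S := by
    rw [← hun]
    exact (hm.congr e1.symm).union_union ((hm'.comp hmaps).congr e2.symm) |>.mono_right (by simp)
  have key := intrinsicDist_le_of_path (by norm_num) c m
  have s0 : η 0 = x := by simp [hη, h0]
  have s2 : η 2 = z := by simp [hη]; norm_num [h1']
  rw [s0, s2] at key
  refine key.trans ?_
  have h_add := eVariationOn.Icc_add_Icc η (a := 0) (b := 1) (c := 2) (s := univ)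
    (by norm_num) (by norm_num) (mem_univ _)
  simp only [univ_inter] at h_add
  rw [← h_add, eVariationOn.eq_of_eqOn e1, eVariationOn.eq_of_eqOn e2]
  have mono : MonotoneOn (fun t : ℝ => t - 1) (Icc 1 2) := fun s _ t _ hst => by
    simp only; linarith
  calc _ ≤ (intrinsicDist S x y + ε/2) + (intrinsicDist S y z + ε/2) :=
        add_le_add hl.le ((eVariationOn.comp_le_of_monotoneOn δ _ mono hmaps).trans hl'.le)
    _ = _ := by
        rw [add_add_add_comm, ENNReal.add_halves]

theorem intrinsicDist_self {n : ℕ} {S : Set (Euc n)} {x : Euc n} (hx : x ∈ S) :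
    intrinsicDist S x x = 0 := by
  have := intrinsicDist_le_of_segment (S := S) (x := x) (y := x) (by simpa using hx)
  simpa using this

theorem ball_segment_subset {n : ℕ} {S : Set (Euc n)} {x y : Euc n} {r : ℝ}
    (h : ball x r ⊆ S) (hy : y ∈ ball x r) : segment ℝ x y ⊆ S :=
  ((convex_ball x r).segment_subset (mem_ball_self (pos_of_mem_ball hy)) hy).trans h

theorem IsEucDomain.intrinsicDist_ne_top {n : ℕ} {W : Set (Euc n)} (hW : IsEucDomain W)
    {x y : Euc n} (hx : x ∈ W) (hy : y ∈ W) : intrinsicDist W x y ≠ ⊤ := by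
  have hloc : ∀ z ∈ W, ∀ᶠ u in nhds z, intrinsicDist W z u < ⊤ := by
    intro z hz
    obtain ⟨r, hr, hb⟩ := Metric.isOpen_iff.1 hW.1 z hz
    filter_upwards [ball_mem_nhds z hr] with u hu
    exact (intrinsicDist_le_of_segment (ball_segment_subset hb hu)).trans_lt (edist_lt_top _ _)
  set A := {u ∈ W | intrinsicDist W x u < ⊤}
  have hAo : IsOpen A := by
    rw [isOpen_iff_mem_nhds]
    rintro u ⟨hu, hxu⟩
    filter_upwards [hloc u hu, hW.1.mem_nhds hu] with v hv hvW
    exact ⟨hvW, (intrinsicDist_triangle W x u v).trans_lt (ENNReal.add_lt_top.2 ⟨hxu, hv⟩)⟩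
  set B := {u ∈ W | ¬ intrinsicDist W x u < ⊤}
  have hBo : IsOpen B := by
    rw [isOpen_iff_mem_nhds]
    rintro u ⟨hu, hxu⟩
    filter_upwards [hloc u hu, hW.1.mem_nhds hu] with v hv hvW
    refine ⟨hvW, fun h => hxu ?_⟩
    refine (intrinsicDist_triangle W x v u).trans_lt (ENNReal.add_lt_top.2 ⟨h, ?_⟩)
    rwa [intrinsicDist_comm]
  by_contra hcon
  have hyB : y ∈ B := ⟨hy, by simp [hcon]⟩
  have hxA : x ∈ A := ⟨hx, by simp [intrinsicDist_self hx]⟩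
  obtain ⟨u, hu, hA, hB⟩ := hW.2.isPreconnected A B hAo hBo
    (fun u hu => by by_cases h : intrinsicDist W x u < ⊤; exacts [.inl ⟨hu, h⟩, .inr ⟨hu, h⟩])
    ⟨x, hx, hxA⟩ ⟨y, hy, hyB⟩
  exact hB.2 hA.2

/-- A bundled domain. -/
structure Dom (n : ℕ) where
  carrier : Set (Euc n)
  isDom : IsEucDomain carrier

namespace Dom
variable {n : ℕ} (W : Dom n)

/-- The points of the domain, carrying the intrinsic metric. -/
@[ext] structure Pt where
  val : Euc n
  mem : val ∈ W.carrier

instance : MetricSpace W.Pt where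
  dist p q := (intrinsicDist W.carrier p.1 q.1).toReal
  dist_self p := by
    rw [intrinsicDist_self p.2]; rfl
  dist_comm p q := by
    rw [intrinsicDist_comm]
  dist_triangle p q r := by
    have h1 := W.isDom.intrinsicDist_ne_top p.2 q.2
    have h2 := W.isDom.intrinsicDist_ne_top q.2 r.2
    rw [← ENNReal.toReal_add h1 h2]
    exact ENNReal.toReal_mono (ENNReal.add_ne_top.2 ⟨h1, h2⟩) (intrinsicDist_triangle _ _ _ _)
  eq_of_dist_eq_zero {p q} h := by
    change (intrinsicDist W.carrier p.1 q.1).toReal = 0 at h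
    have h1 := W.isDom.intrinsicDist_ne_top p.2 q.2
    have h2 := (ENNReal.toReal_eq_zero_iff _).1 h |>.resolve_right h1
    have h3 := edist_le_intrinsicDist W.carrier p.1 q.1
    rw [h2] at h3
    exact Pt.ext (edist_le_zero.1 h3)

theorem pt_dist (p q : W.Pt) : dist p q = (intrinsicDist W.carrier p.1 q.1).toReal := rfl

/-- The metric completion of the domain. -/
abbrev X : Type := UniformSpace.Completion W.Pt

/-- The inclusion of the domain in its completion (junk outside the domain). -/
def ι (u : Euc n) : W.X :=
  open Classical in
  if h : u ∈ W.carrier then ((Pt.mk u h : W.Pt) : W.X)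
  else ((Pt.mk _ W.isDom.2.nonempty.some_mem : W.Pt) : W.X)

variable {W}

theorem ι_eq {u : Euc n} (h : u ∈ W.carrier) : W.ι u = ((Pt.mk u h : W.Pt) : W.X) := by
  simp [ι, h]

theorem dist_ι {u v : Euc n} (hu : u ∈ W.carrier) (hv : v ∈ W.carrier) :
    dist (W.ι u) (W.ι v) = (intrinsicDist W.carrier u v).toReal := by
  rw [ι_eq hu, ι_eq hv, UniformSpace.Completion.dist_eq]; rfl

theorem ofReal_dist_ι {u v : Euc n} (hu : u ∈ W.carrier) (hv : v ∈ W.carrier) :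
    ENNReal.ofReal (dist (W.ι u) (W.ι v)) = intrinsicDist W.carrier u v := by
  rw [dist_ι hu hv, ENNReal.ofReal_toReal (W.isDom.intrinsicDist_ne_top hu hv)]

theorem le_dist_ι {u v : Euc n} (hu : u ∈ W.carrier) (hv : v ∈ W.carrier) :
    dist u v ≤ dist (W.ι u) (W.ι v) := by
  have h := edist_le_intrinsicDist W.carrier u v
  rw [← ofReal_dist_ι hu hv, edist_dist] at h
  exact (ENNReal.ofReal_le_ofReal_iff dist_nonneg).1 h

theorem dist_ι_of_segment {u v : Euc n} (h : segment ℝ u v ⊆ W.carrier) :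
    dist (W.ι u) (W.ι v) = dist u v := by
  have hu := h (left_mem_segment ℝ u v)
  have hv := h (right_mem_segment ℝ u v)
  refine le_antisymm ?_ (le_dist_ι hu hv)
  have h := intrinsicDist_le_of_segment h
  rw [← ofReal_dist_ι hu hv, edist_dist] at h
  exact (ENNReal.ofReal_le_ofReal_iff dist_nonneg).1 h

variable (W) in
/-- The support map from the completion to Euclidean space. -/
def π : W.X → Euc n := UniformSpace.Completion.extension (fun p : W.Pt => p.1)

theorem lipschitz_val : LipschitzWith 1 (fun p : W.Pt => p.1) := by
  refine LipschitzWith.of_dist_le_mul fun p q => ?_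
  have h := le_dist_ι p.2 q.2
  rw [dist_ι p.2 q.2] at h
  simpa [pt_dist] using h

theorem lipschitz_π : LipschitzWith 1 W.π :=
  lipschitz_val.completion_extension

theorem dist_π_le (ξ ζ : W.X) : dist (W.π ξ) (W.π ζ) ≤ dist ξ ζ := by
  simpa using lipschitz_π.dist_le_mul ξ ζ

@[simp] theorem π_ι {u : Euc n} (h : u ∈ W.carrier) : W.π (W.ι u) = u := by
  rw [ι_eq h, π, UniformSpace.Completion.extension_coe lipschitz_val.uniformContinuous]

theorem exists_near (ξ : W.X) {ε : ℝ} (hε : 0 < ε) : ∃ u ∈ W.carrier, dist (W.ι u) ξ < ε := by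
  have := (UniformSpace.Completion.denseRange_coe (α := W.Pt)).exists_dist_lt ξ hε
  obtain ⟨p, hp⟩ := this
  exact ⟨p.1, p.2, by rw [ι_eq p.2, dist_comm]; exact hp⟩

/-- Boundary elements of the completion. -/
def Bd (ξ : W.X) : Prop := ∀ u ∈ W.carrier, ξ ≠ W.ι u

theorem isOpen (W : Dom n) : IsOpen W.carrier := W.isDom.1

theorem Bd.π_notMem {ξ : W.X} (h : Bd ξ) : W.π ξ ∉ W.carrier := by
  intro hm
  obtain ⟨r, hr, hb⟩ := Metric.isOpen_iff.1 W.isOpen _ hm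
  refine h _ hm (eq_of_forall_dist_le fun ε hε => ?_)
  obtain ⟨u, hu, hd⟩ := exists_near ξ (lt_min hr (half_pos hε))
  have h1 := dist_π_le (W.ι u) ξ
  rw [π_ι hu] at h1
  have h2 : segment ℝ (W.π ξ) u ⊆ W.carrier :=
    ball_segment_subset hb (by
      rw [mem_ball]; exact h1.trans_lt (hd.trans_le (min_le_left _ _)))
  have h3 := dist_ι_of_segment h2
  have h4 := dist_triangle_left ξ (W.ι (W.π ξ)) (W.ι u)
  rw [dist_comm (W.ι u) (W.ι _), h3, dist_comm _ u] at h4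
  have := min_le_right r (ε / 2)
  linarith

theorem bd_of_π_notMem {ξ : W.X} (h : W.π ξ ∉ W.carrier) : Bd ξ := by
  rintro u hu rfl
  rw [π_ι hu] at h
  exact h hu

theorem π_mem_closure (ξ : W.X) : W.π ξ ∈ closure W.carrier := by
  rw [Metric.mem_closure_iff]
  intro ε hε
  obtain ⟨u, hu, hd⟩ := exists_near ξ hε
  refine ⟨u, hu, ?_⟩
  have h1 := dist_π_le (W.ι u) ξ
  rw [π_ι hu] at h1
  rw [dist_comm]; linarith

theorem Bd.π_mem_frontier {ξ : W.X} (h : Bd ξ) : W.π ξ ∈ frontier W.carrier :=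
  ⟨π_mem_closure ξ, by rw [W.isOpen.interior_eq]; exact h.π_notMem⟩

theorem dist_ι_tendsto {u : Euc n} (hu : u ∈ W.carrier) {α : Type*} {l : Filter α}
    {s : α → Euc n} (hs : Tendsto s l (nhds u)) :
    Tendsto (fun k => W.ι (s k)) l (nhds (W.ι u)) := by
  obtain ⟨r, hr, hb⟩ := Metric.isOpen_iff.1 W.isOpen _ hu
  rw [tendsto_iff_dist_tendsto_zero] at hs ⊢
  refine hs.congr' ?_
  filter_upwards [hs.eventually (gt_mem_nhds hr)] with k hk
  rw [dist_comm, dist_comm _ (W.ι u), dist_ι_of_segment (ball_segment_subset hb (by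
    rw [mem_ball]; exact hk))]

theorem continuousOn_ι : ContinuousOn W.ι W.carrier := fun _ hu =>
  dist_ι_tendsto hu tendsto_id |>.mono_left nhdsWithin_le_nhds

/-- Near-geodesics can be split at any level of a continuous function. -/
theorem exists_split {u v : Euc n} (hu : u ∈ W.carrier) (hv : v ∈ W.carrier) {ε : ℝ} (hε : 0 < ε)
    {g : Euc n → ℝ} (hg : ContinuousOn g W.carrier) {c : ℝ} (hc : g u ≤ c) (hc' : c ≤ g v) :
    ∃ z ∈ W.carrier, g z = c ∧
      dist (W.ι u) (W.ι z) + dist (W.ι z) (W.ι v) ≤ dist (W.ι u) (W.ι v) + ε := by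
  have hlt : intrinsicDist W.carrier u v < intrinsicDist W.carrier u v + ENNReal.ofReal ε :=
    ENNReal.lt_add_right (W.isDom.intrinsicDist_ne_top hu hv) (by simpa using hε)
  conv_lhs at hlt => rw [intrinsicDist]
  simp only [iInf_lt_iff] at hlt
  obtain ⟨γ, hγ, h0, h1, hm, hl⟩ := hlt
  have := intermediate_value_Icc zero_le_one (hg.comp hγ hm)
  obtain ⟨t, ht, htc⟩ := this ⟨by simpa [h0] using hc, by simpa [h1] using hc'⟩
  refine ⟨γ t, hm ht, htc, ?_⟩
  have e1 := intrinsicDist_le_of_path ht.1 (hγ.mono (Icc_subset_Icc_right ht.2))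
    (hm.mono_left (Icc_subset_Icc_right ht.2))
  have e2 := intrinsicDist_le_of_path ht.2 (hγ.mono (Icc_subset_Icc_left ht.1))
    (hm.mono_left (Icc_subset_Icc_left ht.1))
  have h_add := eVariationOn.Icc_add_Icc γ (a := 0) (b := t) (c := 1) (s := univ)
    ht.1 ht.2 (mem_univ _)
  simp only [univ_inter] at h_add
  have e3 := (add_le_add e1 e2).trans (h_add.trans_le hl.le)
  rw [h0, h1, ← ofReal_dist_ι hu (hm ht), ← ofReal_dist_ι (hm ht) hv, ← ofReal_dist_ι hu hv,
    ← ENNReal.ofReal_add dist_nonneg dist_nonneg,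
    ← ENNReal.ofReal_add dist_nonneg hε.le] at e3
  exact (ENNReal.ofReal_le_ofReal_iff (by positivity)).1 e3

end Dom

namespace Dom
variable {n : ℕ} {W : Dom n}

theorem exists_lim (s : HBSeq W.carrier) :
    ∃ ξ : W.X, Tendsto (fun k => W.ι (s.seq k)) atTop (nhds ξ) := by
  refine cauchySeq_tendsto_of_complete (Metric.cauchySeq_iff.2 fun ε hε => ?_)
  obtain ⟨N, hN⟩ := s.cauchy (ENNReal.ofReal ε) (by simpa using hε)
  refine ⟨N, fun j hj k hk => ?_⟩
  have := hN j hj k hk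
  rw [← ofReal_dist_ι (s.mem j) (s.mem k)] at this
  exact (ENNReal.ofReal_lt_ofReal_iff hε).1 this

theorem tendsto_intrinsicDist {s t : ℕ → Euc n} (hs : ∀ k, s k ∈ W.carrier)
    (ht : ∀ k, t k ∈ W.carrier) {ξ ζ : W.X} (h1 : Tendsto (fun k => W.ι (s k)) atTop (nhds ξ))
    (h2 : Tendsto (fun k => W.ι (t k)) atTop (nhds ζ)) :
    Tendsto (fun k => intrinsicDist W.carrier (s k) (t k)) atTop
      (nhds (ENNReal.ofReal (dist ξ ζ))) := by
  have := (ENNReal.continuous_ofReal.tendsto _).comp (h1.dist h2)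
  refine this.congr fun k => ?_
  simp only [Function.comp]
  rw [ofReal_dist_ι (hs k) (ht k)]

theorem tendsto_intrinsicDist_zero_iff {s t : ℕ → Euc n} (hs : ∀ k, s k ∈ W.carrier)
    (ht : ∀ k, t k ∈ W.carrier) {ξ ζ : W.X} (h1 : Tendsto (fun k => W.ι (s k)) atTop (nhds ξ))
    (h2 : Tendsto (fun k => W.ι (t k)) atTop (nhds ζ)) :
    Tendsto (fun k => intrinsicDist W.carrier (s k) (t k)) atTop (nhds 0) ↔ ξ = ζ := by
  have h := tendsto_intrinsicDist hs ht h1 h2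
  constructor
  · intro h0
    have := tendsto_nhds_unique h h0
    rw [ENNReal.ofReal_eq_zero] at this
    exact dist_le_zero.1 this
  · rintro rfl
    simpa using h

/-- The point of the completion represented by an element of the Hausdorff boundary. -/
def pt (a : HausdorffBoundary W.carrier) : W.X :=
  Quot.lift (fun s => (exists_lim s).choose) (fun s t hst =>
    (tendsto_intrinsicDist_zero_iff s.mem t.mem (exists_lim s).choose_spec
      (exists_lim t).choose_spec).1 hst) a

theorem tendsto_pt (s : HBSeq W.carrier) :
    Tendsto (fun k => W.ι (s.seq k)) atTop (nhds (pt (Quot.mk (HBEquiv W.carrier) s))) :=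
  (exists_lim s).choose_spec

theorem tendsto_out (a : HausdorffBoundary W.carrier) :
    Tendsto (fun k => W.ι ((Quot.out a).seq k)) atTop (nhds (pt a)) := by
  have := tendsto_pt (Quot.out a)
  have e : Quot.mk (HBEquiv W.carrier) (Quot.out a) = a := Quot.out_eq a
  rwa [e] at this

theorem bd_pt (a : HausdorffBoundary W.carrier) : Bd (pt a) := by
  intro u hu h
  refine (Quot.out a).notConv ⟨u, hu, ?_⟩
  exact (tendsto_intrinsicDist_zero_iff (Quot.out a).mem (fun _ => hu) (tendsto_out a)
    tendsto_const_nhds).2 h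

theorem exists_pt {ξ : W.X} (h : Bd ξ) : ∃ a : HausdorffBoundary W.carrier, pt a = ξ := by
  choose s hs hd using fun k : ℕ => exists_near ξ (ε := 1 / ((k : ℝ) + 1)) (by positivity)
  have hlim : Tendsto (fun k => W.ι (s k)) atTop (nhds ξ) := by
    rw [tendsto_iff_dist_tendsto_zero]
    exact squeeze_zero (fun _ => dist_nonneg) (fun k => (hd k).le)
      tendsto_one_div_add_atTop_nhds_zero_nat
  let S : HBSeq W.carrier :=
    { seq := s
      mem := hs
      cauchy := fun ε hε => by
        by_cases htop : ε = ⊤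
        · refine ⟨0, fun j _ k _ => ?_⟩
          rw [htop]
          exact (W.isDom.intrinsicDist_ne_top (hs j) (hs k)).lt_top
        · obtain ⟨N, hN⟩ := Metric.cauchySeq_iff.1 hlim.cauchySeq ε.toReal
            (ENNReal.toReal_pos hε.ne' htop)
          refine ⟨N, fun j hj k hk => ?_⟩
          rw [← ofReal_dist_ι (hs j) (hs k)]
          exact (ENNReal.ofReal_lt_iff_lt_toReal dist_nonneg htop).2 (hN j hj k hk)
      notConv := by
        rintro ⟨u, hu, hlim'⟩
        exact h u hu ((tendsto_intrinsicDist_zero_iff hs (fun _ => hu) hlim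
          tendsto_const_nhds).1 hlim') }
  exact ⟨Quot.mk _ S, tendsto_nhds_unique (tendsto_pt S) hlim⟩

theorem pt_injective : Function.Injective (pt : HausdorffBoundary W.carrier → W.X) := by
  intro a b h
  rw [← Quot.out_eq a, ← Quot.out_eq b]
  exact Quot.sound ((tendsto_intrinsicDist_zero_iff (Quot.out a).mem (Quot.out b).mem
    (tendsto_out a) (tendsto_out b)).2 h)

theorem hbDist_eq (a b : HausdorffBoundary W.carrier) :
    hbDist a b = ENNReal.ofReal (dist (pt a) (pt b)) :=
  (tendsto_intrinsicDist (Quot.out a).mem (Quot.out b).mem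
    (tendsto_out a) (tendsto_out b)).limsup_eq

theorem tendsto_val {s : ℕ → Euc n} (hs : ∀ k, s k ∈ W.carrier) {ξ : W.X}
    (h : Tendsto (fun k => W.ι (s k)) atTop (nhds ξ)) : Tendsto s atTop (nhds (W.π ξ)) := by
  refine ((lipschitz_π.continuous.tendsto ξ).comp h).congr fun k => ?_
  simp [hs k]

theorem hbSupport_eq (a : HausdorffBoundary W.carrier) : hbSupport a = W.π (pt a) :=
  (tendsto_val (Quot.out a).mem (tendsto_out a)).limUnder_eq

instance : Nonempty W.X := ⟨W.ι 0⟩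

/-- A bijective isometry between the boundaries, viewed inside the completions. -/
structure BdIso (U V : Dom n) where
  F : U.X → V.X
  G : V.X → U.X
  F_bd : ∀ {ξ}, Bd ξ → Bd (F ξ)
  G_bd : ∀ {ξ}, Bd ξ → Bd (G ξ)
  GF : ∀ {ξ}, Bd ξ → G (F ξ) = ξ
  FG : ∀ {ξ}, Bd ξ → F (G ξ) = ξ
  F_dist : ∀ {ξ ζ}, Bd ξ → Bd ζ → dist (F ξ) (F ζ) = dist ξ ζ

/-- The inverse boundary isometry. -/
def BdIso.symm {U V : Dom n} (f : BdIso U V) : BdIso V U where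
  F := f.G
  G := f.F
  F_bd := f.G_bd
  G_bd := f.F_bd
  GF := f.FG
  FG := f.GF
  F_dist h1 h2 := by rw [← f.F_dist (f.G_bd h1) (f.G_bd h2), f.FG h1, f.FG h2]

theorem exists_bdIso {U V : Dom n} (f : HausdorffBoundary U.carrier → HausdorffBoundary V.carrier)
    (hf : IsHBIsometry f) : ∃ F : BdIso U V, ∀ a, F.F (pt a) = pt (f a) := by
  classical
  obtain ⟨g, hgf, hfg⟩ := Function.bijective_iff_has_inverse.1 hf.1
  let F : U.X → V.X := fun ξ =>
    if h : Bd ξ then pt (f (exists_pt h).choose) else Classical.arbitrary _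
  let G : V.X → U.X := fun ξ =>
    if h : Bd ξ then pt (g (exists_pt h).choose) else Classical.arbitrary _
  have hF : ∀ a, F (pt a) = pt (f a) := by
    intro a
    have h := (exists_pt (bd_pt a)).choose_spec
    simp only [F, bd_pt a, dif_pos]
    rw [pt_injective h]
  have hG : ∀ a, G (pt a) = pt (g a) := by
    intro a
    have h := (exists_pt (bd_pt a)).choose_spec
    simp only [G, bd_pt a, dif_pos]
    rw [pt_injective h]
  refine ⟨⟨F, G, ?_, ?_, ?_, ?_, ?_⟩, hF⟩
  · intro ξ h; obtain ⟨a, rfl⟩ := exists_pt h; rw [hF]; exact bd_pt _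
  · intro ξ h; obtain ⟨a, rfl⟩ := exists_pt h; rw [hG]; exact bd_pt _
  · intro ξ h; obtain ⟨a, rfl⟩ := exists_pt h; rw [hF, hG, hgf a]
  · intro ξ h; obtain ⟨a, rfl⟩ := exists_pt h; rw [hG, hF, hfg a]
  · intro ξ ζ h h'
    obtain ⟨a, rfl⟩ := exists_pt h
    obtain ⟨b, rfl⟩ := exists_pt h'
    have := hf.2 a b
    rw [hbDist_eq, hbDist_eq, ← hF, ← hF] at this
    exact (ENNReal.ofReal_eq_ofReal_iff dist_nonneg dist_nonneg).1 this

/-- `ξ` is seen from the set `C`: distances to points of `C` are Euclidean. -/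
def Sees (C : Set (Euc n)) (ξ : W.X) : Prop :=
  C ⊆ W.carrier ∧ ∀ z ∈ C, dist (W.ι z) ξ ≤ dist z (W.π ξ)

theorem exists_sees {C : Set (Euc n)} (hC : Convex ℝ C) (hCW : C ⊆ W.carrier) {e : Euc n}
    (he : e ∈ closure C) : ∃ ξ : W.X, W.π ξ = e ∧ Sees C ξ := by
  obtain ⟨s, hs, hlim⟩ := mem_closure_iff_seq_limit.1 he
  have hd : ∀ j k, dist (W.ι (s j)) (W.ι (s k)) = dist (s j) (s k) := fun j k =>
    dist_ι_of_segment ((hC.segment_subset (hs j) (hs k)).trans hCW)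
  have hc : CauchySeq fun k => W.ι (s k) := by
    have := hlim.cauchySeq
    rw [Metric.cauchySeq_iff] at this ⊢
    simpa only [hd] using this
  obtain ⟨ξ, hξ⟩ := cauchySeq_tendsto_of_complete hc
  have hπ : W.π ξ = e := tendsto_nhds_unique (tendsto_val (fun k => hCW (hs k)) hξ) hlim
  refine ⟨ξ, hπ, hCW, fun z hz => ?_⟩
  rw [hπ]
  refine le_of_tendsto_of_tendsto' (tendsto_const_nhds.dist hξ) (tendsto_const_nhds.dist hlim)
    fun k => ?_
  rw [dist_ι_of_segment ((hC.segment_subset hz (hs k)).trans hCW)]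

theorem Sees.mono {C C' : Set (Euc n)} {ξ : W.X} (h : Sees C ξ) (hs : C' ⊆ C) : Sees C' ξ :=
  ⟨hs.trans h.1, fun z hz => h.2 z (hs hz)⟩

/-- Two elements seen from a common set are joined through any limit point of that set. -/
theorem dist_le_of_sees {C C' : Set (Euc n)} {ξ ζ : W.X} (h : Sees C ξ) (h' : Sees C' ζ)
    {q : Euc n} (hq : q ∈ closure (C ∩ C')) :
    dist ξ ζ ≤ dist q (W.π ξ) + dist q (W.π ζ) := by
  obtain ⟨s, hs, hlim⟩ := mem_closure_iff_seq_limit.1 hq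
  refine ge_of_tendsto' ((hlim.dist tendsto_const_nhds).add (hlim.dist tendsto_const_nhds))
    fun k => ?_
  exact (dist_triangle_left _ _ (W.ι (s k))).trans (add_le_add (h.2 _ (hs k).1) (h'.2 _ (hs k).2))

end Dom

namespace Dom
variable {n : ℕ} {W : Dom n}

theorem exists_split_X {ξ ζ : W.X} {ε : ℝ} (hε : 0 < ε)
    {g : Euc n → ℝ} (hg : ContinuousOn g W.carrier) {c r : ℝ} (hr : 0 < r)
    (h1 : ∀ u ∈ W.carrier, dist (W.ι u) ξ < r → g u ≤ c)
    (h2 : ∀ u ∈ W.carrier, dist (W.ι u) ζ < r → c ≤ g u) :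
    ∃ z ∈ W.carrier, g z = c ∧ dist ξ (W.ι z) + dist (W.ι z) ζ ≤ dist ξ ζ + ε := by
  have hδ : 0 < min r (ε / 5) := lt_min hr (by positivity)
  have hδ' : min r (ε / 5) ≤ ε / 5 := min_le_right _ _
  obtain ⟨u, hu, hud⟩ := exists_near ξ hδ
  obtain ⟨v, hv, hvd⟩ := exists_near ζ hδ
  obtain ⟨z, hz, hgz, hd⟩ := exists_split hu hv (ε := ε / 5) (by positivity) hg
    (h1 u hu (hud.trans_le (min_le_left _ _))) (h2 v hv (hvd.trans_le (min_le_left _ _)))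
  refine ⟨z, hz, hgz, ?_⟩
  have t1 := dist_triangle_left ξ (W.ι z) (W.ι u)
  have t2 := dist_triangle (W.ι z) (W.ι v) ζ
  have t3 := dist_triangle4 (W.ι u) ξ ζ (W.ι v)
  rw [dist_comm ζ] at t3
  linarith

theorem ball_infDist_subset (m : Euc n) : ball m (infDist m W.carrierᶜ) ⊆ W.carrier := by
  intro z hz
  by_contra h
  have := infDist_le_dist_of_mem (x := m) (show z ∈ W.carrierᶜ from h)
  rw [mem_ball, dist_comm] at hz
  linarith

theorem isClosed_compl (W : Dom n) : IsClosed W.carrierᶜ := W.isOpen.isClosed_compl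

theorem infDist_pos (hW : W.carrierᶜ.Nonempty) {u : Euc n} (hu : u ∈ W.carrier) :
    0 < infDist u W.carrierᶜ :=
  (W.isClosed_compl.notMem_iff_infDist_pos hW).1 (by simpa using hu)

/-- A complement point on the boundary sphere of an inscribed ball carries a boundary element
seen from the ball. -/
theorem exists_sees_ball {m e : Euc n} {R : ℝ} (hR : 0 < R) (hb : ball m R ⊆ W.carrier)
    (he : dist e m ≤ R) (heW : e ∉ W.carrier) :
    ∃ ξ : W.X, Bd ξ ∧ W.π ξ = e ∧ Sees (ball m R) ξ := by
  obtain ⟨ξ, h1, h2⟩ := exists_sees (W := W) (convex_ball m R) hb (e := e)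
    (by rw [closure_ball m hR.ne']; exact he)
  exact ⟨ξ, bd_of_π_notMem (by rwa [h1]), h1, h2⟩

theorem exists_nearest (hW : W.carrierᶜ.Nonempty) {u : Euc n} (hu : u ∈ W.carrier) :
    ∃ ξ : W.X, Bd ξ ∧ dist (W.ι u) ξ ≤ infDist u W.carrierᶜ := by
  obtain ⟨e, he, hd⟩ := W.isClosed_compl.exists_infDist_eq_dist hW u
  have hR := infDist_pos hW hu
  obtain ⟨ξ, h1, h2, h3⟩ := exists_sees_ball hR (ball_infDist_subset u)
    (by rw [dist_comm, hd]) he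
  refine ⟨ξ, h1, ?_⟩
  have := h3.2 u (mem_ball_self hR)
  rwa [h2, ← hd] at this

/-- Two boundary elements joined by a boundary interval. -/
structure Edge (a b : W.X) : Prop where
  bd_left : Bd a
  bd_right : Bd b
  ne : W.π a ≠ W.π b
  sees_left : Sees (openSegment ℝ (W.π a) (W.π b)) a
  sees_right : Sees (openSegment ℝ (W.π a) (W.π b)) b

theorem Edge.dist_eq {a b : W.X} (h : Edge a b) : dist a b = dist (W.π a) (W.π b) := by
  refine le_antisymm ?_ (dist_π_le _ _)
  have := dist_le_of_sees h.sees_left h.sees_right (q := W.π a) (by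
    rw [inter_self, closure_openSegment]; exact left_mem_segment ℝ _ _)
  simpa using this

theorem mem_openSegment_of_dist {x y z : Euc n} {T d : ℝ} (hxy : dist x y = d) (h1 : dist x z ≤ T)
    (h2 : dist z y ≤ d - T) (hT : 0 < T) (hTd : T < d) : z ∈ openSegment ℝ x y := by
  have h3 := dist_triangle x z y
  have hw : Wbtw ℝ x z y := dist_add_dist_eq_iff.1 (by linarith)
  have hzx : z ≠ x := by rintro rfl; linarith [hxy ▸ h2]
  have hzy : z ≠ y := by rintro rfl; linarith [hxy ▸ h1]
  have hs := hw.mem_segment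
  rcases (segment_eq_image_lineMap ℝ x y ▸ hs : z ∈ AffineMap.lineMap x y '' Icc (0:ℝ) 1) with
    ⟨t, ht, rfl⟩
  rw [openSegment_eq_image_lineMap]
  refine ⟨t, ⟨ht.1.lt_of_ne ?_, ht.2.lt_of_ne ?_⟩, rfl⟩
  · rintro rfl; simp at hzx
  · rintro rfl; simp at hzy

theorem Edge.no_bd_between {U V : Dom n} (f : BdIso U V) {a b : U.X} (h : Edge a b)
    {C : V.X} (hC : Bd C) {T : ℝ} (hT : 0 < T) (hTd : T < dist a b) (h1 : dist (f.F a) C ≤ T)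
    (h2 : dist C (f.F b) ≤ dist a b - T) : False := by
  rw [← f.FG hC, f.F_dist h.bd_left (f.G_bd hC)] at h1
  rw [← f.FG hC, f.F_dist (f.G_bd hC) h.bd_right] at h2
  have := mem_openSegment_of_dist h.dist_eq.symm ((dist_π_le _ _).trans h1)
    ((dist_π_le _ _).trans h2) hT hTd
  exact (f.G_bd hC).π_notMem (h.sees_left.1 this)

theorem dist_midpoint_sq (x y z : Euc n) :
    dist z (midpoint ℝ x y) ^ 2 = (dist x z ^ 2 + dist z y ^ 2) / 2 - dist x y ^ 2 / 4 := by
  have h := parallelogram_law_with_norm ℝ (z - x) (z - y)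
  have e1 : z - x + (z - y) = (2:ℝ) • (z - midpoint ℝ x y) := by
    rw [midpoint_eq_smul_add, invOf_eq_inv]; module
  have e2 : z - x - (z - y) = y - x := by abel
  rw [e1, e2, norm_smul] at h
  rw [dist_eq_norm, dist_comm x z, dist_eq_norm, dist_eq_norm, dist_comm x y, dist_eq_norm]
  simp only [Real.norm_ofNat] at h
  nlinarith

theorem exists_mid {U V : Dom n} (f : BdIso U V) {a b : U.X} (h : Edge a b) :
    ∃ u ∈ V.carrier, dist (f.F a) (V.ι u) ≤ dist a b / 2 ∧
      dist (V.ι u) (f.F b) ≤ dist a b / 2 := by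
  set d := dist a b with hd
  have hdpos : 0 < d := by rw [hd, h.dist_eq]; exact dist_pos.2 h.ne
  set A := f.F a
  set B := f.F b
  have hAB : dist A B = d := f.F_dist h.bd_left h.bd_right
  have hV : V.carrierᶜ.Nonempty := ⟨_, (f.F_bd h.bd_left).π_notMem⟩
  have key : ∀ k : ℕ, ∃ z ∈ V.carrier, dist A (V.ι z) = d / 2 ∧
      dist A (V.ι z) + dist (V.ι z) B ≤ d + 1 / ((k:ℝ) + 1) := by
    intro k
    rw [← hAB]
    refine exists_split_X (by positivity) (g := fun z => dist A (V.ι z)) (c := dist A B / 2)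
      (r := d / 2) (fun v hv => tendsto_const_nhds.dist (continuousOn_ι v hv)) (by positivity) ?_ ?_
    · intro u _ hu'
      rw [hAB, dist_comm]; exact hu'.le
    · intro u _ hu'
      have := dist_triangle A (V.ι u) B
      linarith
  choose z hz hz1 hz2 using key
  have hz3 : ∀ k, dist (V.ι (z k)) B ≤ d / 2 + 1 / ((k:ℝ) + 1) := fun k => by
    linarith [hz1 k, hz2 k]
  -- uniform clearance
  have hmid : midpoint ℝ (U.π a) (U.π b) ∈ U.carrier := by
    apply h.sees_left.1
    rw [openSegment_eq_image_lineMap]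
    exact ⟨1/2, by norm_num, by simp [midpoint, AffineMap.lineMap_apply]⟩
  obtain ⟨r, hr, hb⟩ := Metric.isOpen_iff.1 U.isOpen _ hmid
  have hlow : ∀ k : ℕ, r ^ 2 ≤ d * (infDist (z k) V.carrierᶜ + 1 / ((k:ℝ) + 1)) +
      (infDist (z k) V.carrierᶜ + 1 / ((k:ℝ) + 1)) ^ 2 := by
    intro k
    obtain ⟨ξ, hξ, hξd⟩ := exists_nearest hV (hz k)
    set e := infDist (z k) V.carrierᶜ + 1 / ((k:ℝ) + 1)
    have hk : 0 < 1 / ((k:ℝ) + 1) := by positivity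
    have h1 : dist A ξ ≤ d / 2 + e := by
      have := dist_triangle A (V.ι (z k)) ξ
      linarith [hz1 k]
    have h2 : dist ξ B ≤ d / 2 + e := by
      have := dist_triangle_left ξ B (V.ι (z k))
      linarith [hz3 k]
    rw [← f.FG hξ, f.F_dist h.bd_left (f.G_bd hξ)] at h1
    rw [← f.FG hξ, f.F_dist (f.G_bd hξ) h.bd_right] at h2
    have h1' := (dist_π_le _ _).trans h1
    have h2' := (dist_π_le _ _).trans h2
    have hm := dist_midpoint_sq (U.π a) (U.π b) (U.π (f.G ξ))
    have hge : r ≤ dist (U.π (f.G ξ)) (midpoint ℝ (U.π a) (U.π b)) := by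
      by_contra hlt
      exact (f.G_bd hξ).π_notMem (hb (not_le.1 hlt))
    rw [← h.dist_eq, ← hd] at hm
    have q1 := pow_le_pow_left₀ dist_nonneg h1' 2
    have q2 := pow_le_pow_left₀ dist_nonneg h2' 2
    have q3 := pow_le_pow_left₀ hr.le hge 2
    nlinarith
  -- a convergent subsequence
  have hbdd : ∀ k, z k ∈ closedBall (V.π A) (d / 2) := fun k => by
    have := dist_π_le A (V.ι (z k))
    rw [π_ι (hz k), hz1 k] at this
    rwa [mem_closedBall, dist_comm]
  obtain ⟨u, -, φ, hφ, hlim⟩ := (isCompact_closedBall (V.π A) (d / 2)).tendsto_subseq hbdd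
  have hone : Tendsto (fun k => 1 / ((φ k : ℝ) + 1)) atTop (nhds 0) :=
    tendsto_one_div_add_atTop_nhds_zero_nat.comp hφ.tendsto_atTop
  have huV : u ∈ V.carrier := by
    by_contra hu
    have h0 : infDist u V.carrierᶜ = 0 := by
      have := infDist_le_dist_of_mem (x := u) (show u ∈ V.carrierᶜ from hu)
      exact le_antisymm (by simpa using this) infDist_nonneg
    have hI : Tendsto (fun k => infDist (z (φ k)) V.carrierᶜ) atTop (nhds 0) := by
      rw [← h0]
      exact ((continuous_infDist_pt _).tendsto u).comp hlim
    have hE := hI.add hone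
    have := (hE.const_mul d).add (hE.pow 2)
    have := ge_of_tendsto' this fun k => hlow (φ k)
    norm_num at this
    nlinarith [pow_pos hr 2]
  have hι := dist_ι_tendsto huV hlim
  refine ⟨u, huV, ?_, ?_⟩
  · exact le_of_tendsto' (tendsto_const_nhds.dist hι) fun k => (hz1 (φ k)).le
  · have := le_of_tendsto_of_tendsto' (hι.dist tendsto_const_nhds) (hone.const_add (d/2))
      fun k => hz3 (φ k)
    simpa using this

theorem exists_step {u : Euc n} {B : W.X} (hB : Bd B) {h : ℝ} (hh : 0 < h)
    (hb : closedBall u h ⊆ W.carrier) :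
    ∃ z, dist z u = h ∧ dist (W.ι z) B ≤ dist (W.ι u) B - h := by
  have hu := hb (mem_closedBall_self hh.le)
  have hsub : ∀ z, dist z u ≤ h → dist (W.ι u) (W.ι z) = dist u z := fun z hz =>
    dist_ι_of_segment (((convex_closedBall u h).segment_subset (mem_closedBall_self hh.le) hz).trans
      hb)
  have hfar : h < dist u (W.π B) := by
    by_contra hlt
    exact hB.π_notMem (hb (by rw [mem_closedBall, dist_comm]; exact not_lt.1 hlt))
  have key : ∀ k : ℕ, ∃ z ∈ W.carrier, dist z u = h ∧
      dist (W.ι u) (W.ι z) + dist (W.ι z) B ≤ dist (W.ι u) B + 1 / ((k:ℝ) + 1) := by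
    intro k
    refine exists_split_X (by positivity) (g := fun z => dist z u) (c := h)
      (r := min h (dist u (W.π B) - h)) (by fun_prop) (lt_min hh (by linarith)) ?_ ?_
    · intro v hv hv'
      exact ((le_dist_ι hv hu).trans hv'.le).trans (min_le_left _ _)
    · intro v hv hv'
      have h1 := dist_π_le (W.ι v) B
      rw [π_ι hv] at h1
      have h2 := dist_triangle_left u (W.π B) v
      have h3 := min_le_right h (dist u (W.π B) - h)
      linarith
  choose z hz hz1 hz2 using key
  obtain ⟨w, hw, φ, hφ, hlim⟩ := (isCompact_sphere u h).tendsto_subseq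
    (fun k => (hz1 k : z k ∈ sphere u h))
  have hone : Tendsto (fun k => 1 / ((φ k : ℝ) + 1)) atTop (nhds 0) :=
    tendsto_one_div_add_atTop_nhds_zero_nat.comp hφ.tendsto_atTop
  have hι := dist_ι_tendsto (hb (sphere_subset_closedBall hw)) hlim
  refine ⟨w, hw, ?_⟩
  refine le_of_tendsto_of_tendsto' (hι.dist tendsto_const_nhds)
    ((hone.const_add (dist (W.ι u) B - h)).trans (by simp)) fun k => ?_
  have := hz2 (φ k)
  rw [hsub _ (hz1 _).le, dist_comm, hz1] at this
  simp only [Function.comp]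
  linarith

end Dom

namespace Dom
variable {n : ℕ} {W : Dom n}

theorem eq_neg_of_norm {x y : Euc n} {h : ℝ} (hx : ‖x‖ = h) (hy : ‖y‖ = h)
    (hxy : 2 * h ≤ ‖x - y‖) : x = -y := by
  have h1 := parallelogram_law_with_norm ℝ x y
  rw [hx, hy] at h1
  have h0 : 0 ≤ h := hx ▸ norm_nonneg x
  have h2 : ‖x + y‖ = 0 := by nlinarith [norm_nonneg (x + y), sq_nonneg ‖x + y‖]
  exact eq_neg_of_add_eq_zero_left (norm_eq_zero.1 h2)

theorem exists_closedBall_subset {u : Euc n} (hu : u ∈ W.carrier) {r : ℝ} (hr : 0 < r) :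
    ∃ h, 0 < h ∧ h < r ∧ closedBall u h ⊆ W.carrier := by
  obtain ⟨ε, hε, hb⟩ := Metric.isOpen_iff.1 W.isOpen u hu
  refine ⟨min ε r / 2, by positivity, ?_, (closedBall_subset_ball ?_).trans hb⟩
  · have := min_le_right ε r; have := lt_min hε hr; linarith
  · have := min_le_left ε r; have := lt_min hε hr; linarith

theorem opposite_steps {u z w : Euc n} {A B : W.X} {h a b : ℝ}
    (hb : closedBall u h ⊆ W.carrier) (hab : a + b ≤ dist A B)
    (hz : dist z u = h) (hw : dist w u = h) (hz1 : dist A (W.ι z) ≤ a - h)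
    (hw1 : dist (W.ι w) B ≤ b - h) : w - u = -(z - u) := by
  refine eq_neg_of_norm (h := h) (by rw [← dist_eq_norm, hw]) (by rw [← dist_eq_norm, hz]) ?_
  have h1 : dist (W.ι z) (W.ι w) = dist z w := dist_ι_of_segment
    (((convex_closedBall u h).segment_subset hz.le hw.le).trans hb)
  have h2 := dist_triangle4 A (W.ι z) (W.ι w) B
  rw [sub_sub_sub_cancel_right, ← dist_eq_norm, dist_comm]
  linarith

theorem segment_ray_subset {u v : Euc n} {s s' : ℝ} (h0 : 0 ≤ s') (h : s' ≤ s) {C : Set (Euc n)}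
    (hC : segment ℝ u (u + s • v) ⊆ C) : segment ℝ (u + s' • v) (u + s • v) ⊆ C := by
  refine Subset.trans ((convex_segment _ _).segment_subset ?_ (right_mem_segment ℝ _ _)) hC
  rcases h0.eq_or_lt with rfl | h0
  · simp [left_mem_segment]
  rw [segment_eq_image']
  refine ⟨s' / s, ⟨div_nonneg h0.le (h0.le.trans h), div_le_one_of_le₀ h (h0.le.trans h)⟩, ?_⟩
  simp only [add_sub_cancel_left, smul_smul]
  rw [div_mul_cancel₀ _ (h0.trans_le h).ne']

theorem segment_ray_subset' {u v : Euc n} {s s' : ℝ} (h0 : 0 ≤ s') (h : s' ≤ s) {C : Set (Euc n)}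
    (hC : segment ℝ u (u + s • v) ⊆ C) : segment ℝ u (u + s' • v) ⊆ C := by
  refine Subset.trans ((convex_segment _ _).segment_subset (left_mem_segment ℝ _ _) ?_) hC
  exact segment_ray_subset h0 h Subset.rfl (left_mem_segment ℝ _ _)

theorem dist_ray {u v : Euc n} (hv : ‖v‖ = 1) (s t : ℝ) :
    dist (u + s • v) (u + t • v) = |s - t| := by
  rw [dist_eq_norm, add_sub_add_left_eq_sub, ← sub_smul, norm_smul, hv, mul_one, Real.norm_eq_abs]

theorem dist_ray_zero {u v : Euc n} (hv : ‖v‖ = 1) {s : ℝ} (hs : 0 ≤ s) :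
    dist u (u + s • v) = s := by
  rw [dist_self_add_right, norm_smul, hv, mul_one, Real.norm_eq_abs, abs_of_nonneg hs]

/-- Prolongation of a geodesic germ when no boundary element lies metrically between `A` and `B`. -/
theorem ray_prolong {A B : W.X} (hB : Bd B) {d c : ℝ} (hAB : dist A B = d)
    (hc : 0 < c)
    (hno : ∀ C : W.X, Bd C → ∀ T, 0 < T → T < d → dist A C ≤ T → dist C B ≤ d - T → False)
    {u v : Euc n} (hv : ‖v‖ = 1) (hu1 : dist A (W.ι u) ≤ c)
    {h₁ : ℝ} (hh₁ : 0 < h₁)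
    (hseg : segment ℝ u (u + h₁ • v) ⊆ W.carrier) (hB₁ : dist (W.ι (u + h₁ • v)) B ≤ d - c - h₁) :
    ∀ s, 0 ≤ s → s < d - c → segment ℝ u (u + s • v) ⊆ W.carrier ∧
      dist (W.ι (u + s • v)) B ≤ d - c - s := by
  set P : ℝ → Prop := fun s => segment ℝ u (u + s • v) ⊆ W.carrier ∧
      dist (W.ι (u + s • v)) B ≤ d - c - s with hP
  have hmono : ∀ s s', 0 ≤ s' → s' ≤ s → P s → P s' := by
    intro s s' h0 h hs
    have hsub := segment_ray_subset h0 h hs.1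
    refine ⟨segment_ray_subset' h0 h hs.1, ?_⟩
    have h1 := dist_ι_of_segment hsub
    rw [dist_ray hv, abs_sub_comm, abs_of_nonneg (by linarith)] at h1
    have := dist_triangle (W.ι (u + s' • v)) (W.ι (u + s • v)) B
    linarith [hs.2]
  have hAd : ∀ s, 0 ≤ s → P s → dist A (W.ι (u + s • v)) ≤ c + s := by
    intro s hs h
    have h1 := dist_ι_of_segment h.1
    have h2 : dist u (u + s • v) = s := dist_ray_zero hv hs
    have := dist_triangle A (W.ι u) (W.ι (u + s • v))
    linarith
  have hb : ∀ s, 0 ≤ s → P s → s ≤ d - c := fun s _ h => by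
    linarith [dist_nonneg (x := W.ι (u + s • v)) (y := B), h.2]
  set S := {s | 0 ≤ s ∧ P s} with hS
  have hbdd : BddAbove S := ⟨d - c, fun s hs => hb s hs.1 hs.2⟩
  have h1S : h₁ ∈ S := ⟨hh₁.le, hseg, hB₁⟩
  set σ := sSup S with hσ
  have hσ1 : h₁ ≤ σ := le_csSup hbdd h1S
  have hσ0 : 0 < σ := hh₁.trans_le hσ1
  have hσd : σ ≤ d - c := csSup_le ⟨_, h1S⟩ fun s hs => hb s hs.1 hs.2
  have hlt : ∀ s, 0 ≤ s → s < σ → P s := by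
    intro s h0 hs
    obtain ⟨t, ht, hst⟩ := exists_lt_of_lt_csSup ⟨_, h1S⟩ hs
    exact hmono t s h0 hst.le ht.2
  suffices hfin : σ = d - c by
    intro s h0 hs; exact hlt s h0 (hfin ▸ hs)
  by_contra hne
  have hσlt : σ < d - c := lt_of_le_of_ne hσd hne
  set e := u + σ • v with he
  -- the limit point lies in the domain
  have hlim : Tendsto (fun s : ℝ => u + s • v) (nhdsWithin σ (Iio σ)) (nhds e) := by
    have : Continuous fun s : ℝ => u + s • v := by fun_prop
    exact (this.tendsto σ).mono_left nhdsWithin_le_nhds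
  have hev : ∀ᶠ s in nhdsWithin σ (Iio σ), 0 ≤ s ∧ s < σ := by
    filter_upwards [self_mem_nhdsWithin, nhdsWithin_le_nhds (lt_mem_nhds hσ0)] with s h1 h2
    exact ⟨h2.le, h1⟩
  have hid : Tendsto (fun s : ℝ => d - c - s) (nhdsWithin σ (Iio σ)) (nhds (d - c - σ)) := by
    have : Continuous fun s : ℝ => d - c - s := by fun_prop
    exact (this.tendsto σ).mono_left nhdsWithin_le_nhds
  have heW : e ∈ W.carrier := by
    by_contra heW
    set C := (fun s : ℝ => u + s • v) '' Ico 0 σ with hC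
    have hconv : Convex ℝ C := by
      have : (fun s : ℝ => u + s • v) = fun s => AffineMap.lineMap u (u + v) s := by
        ext1 s; simp [AffineMap.lineMap_apply, add_comm]
      rw [hC, this]
      exact (convex_Ico 0 σ).affine_image (AffineMap.lineMap u (u + v))
    have hCW : C ⊆ W.carrier := by
      rintro _ ⟨s, hs, rfl⟩
      exact (hlt s hs.1 hs.2).1 (right_mem_segment ℝ _ _)
    have hecl : e ∈ closure C := by
      refine mem_closure_of_tendsto hlim ?_
      filter_upwards [hev] with s hs using ⟨s, hs, rfl⟩
    obtain ⟨ξ, hξπ, hξ⟩ := exists_sees hconv hCW hecl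
    have hξB : Bd ξ := bd_of_π_notMem (by rwa [hξπ])
    have huC : u ∈ C := ⟨0, ⟨le_rfl, hσ0⟩, by simp⟩
    refine hno ξ hξB (c + σ) (by linarith) (by linarith) ?_ ?_
    · have h1 := hξ.2 u huC
      rw [hξπ] at h1
      have h2 : dist u e = σ := dist_ray_zero hv hσ0.le
      linarith [dist_triangle A (W.ι u) ξ]
    · have h1 : ∀ s, 0 ≤ s ∧ s < σ → dist ξ B ≤ (σ - s) + (d - c - s) := by
        intro s hs
        have h2 := hξ.2 _ ⟨s, hs, rfl⟩
        rw [hξπ, he, dist_ray hv, abs_sub_comm, abs_of_nonneg (by linarith)] at h2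
        linarith [dist_triangle_left ξ B (W.ι (u + s • v)), (hlt s hs.1 hs.2).2]
      have hid' : Tendsto (fun s : ℝ => (σ - s) + (d - c - s)) (nhdsWithin σ (Iio σ))
          (nhds ((σ - σ) + (d - c - σ))) := by
        have : Continuous fun s : ℝ => (σ - s) + (d - c - s) := by fun_prop
        exact (this.tendsto σ).mono_left nhdsWithin_le_nhds
      have := ge_of_tendsto hid' (hev.mono h1)
      linarith
  have hPσ : P σ := by
    constructor
    · intro w hw
      rw [segment_eq_image'] at hw
      obtain ⟨t, ht, rfl⟩ := hw
      simp only [add_sub_cancel_left, smul_smul]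
      rcases ht.2.eq_or_lt with rfl | h1
      · simpa using heW
      · exact (hlt (t * σ) (mul_nonneg ht.1 hσ0.le)
          (by nlinarith)).1 (right_mem_segment ℝ _ _)
    · refine le_of_tendsto_of_tendsto ((dist_ι_tendsto heW hlim).dist tendsto_const_nhds) hid ?_
      filter_upwards [hev] with s hs using (hlt s hs.1 hs.2).2
  obtain ⟨h, hh, hhσ, hball⟩ := exists_closedBall_subset heW hσ0
  obtain ⟨z, hz, hzB⟩ : ∃ z, dist z e = h ∧ dist (W.ι z) B ≤ d - c - σ - h := by
    obtain ⟨z, h1, h2⟩ := exists_step hB hh hball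
    exact ⟨z, h1, h2.trans (by linarith [hPσ.2])⟩
  have hback := hlt (σ - h) (by linarith) (by linarith)
  have hopp := opposite_steps (A := A) (B := B) (a := c + σ) (b := d - c - σ) hball
    (by rw [hAB]; linarith) (z := u + (σ - h) • v) (w := z)
    (by rw [dist_ray hv]; simp [abs_of_pos hh]) hz
    ((hAd _ (by linarith) hback).trans (by linarith)) hzB
  have hzeq : z = u + (σ + h) • v := by
    have : z = e + -(u + (σ - h) • v - e) := by rw [← hopp]; abel
    rw [this, he]; module
  have hmem : σ + h ∈ S := by
    refine ⟨by linarith, ?_, ?_⟩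
    · have hsub : segment ℝ e (u + (σ + h) • v) ⊆ W.carrier := by
        rw [← hzeq]
        exact ((convex_closedBall e h).segment_subset (mem_closedBall_self hh.le) hz.le).trans hball
      intro w hw
      rw [segment_eq_image'] at hw
      obtain ⟨t, ht, rfl⟩ := hw
      simp only [add_sub_cancel_left, smul_smul]
      rcases le_total (t * (σ + h)) σ with h1 | h1
      · exact (hmono σ _ (mul_nonneg ht.1 (by linarith)) h1 hPσ).1 (right_mem_segment ℝ _ _)
      · apply hsub
        rw [segment_eq_image']
        refine ⟨(t * (σ + h) - σ) / h, ⟨div_nonneg (by linarith) hh.le, ?_⟩, ?_⟩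
        · rw [div_le_one hh]; nlinarith [ht.2]
        · have : u + (σ + h) • v - e = h • v := by rw [he]; module
          simp only [this, smul_smul]
          rw [div_mul_cancel₀ _ hh.ne', he]; module
    · rw [← hzeq]; linarith
  linarith [le_csSup hbdd hmem]

end Dom

namespace Dom
variable {n : ℕ}

theorem support_of_ray {W : Dom n} {B : W.X} {u v : Euc n} {d : ℝ} (hd : 0 < d)
    (h : ∀ s, 0 ≤ s → s < d → segment ℝ u (u + s • v) ⊆ W.carrier ∧
      dist (W.ι (u + s • v)) B ≤ d - s) : W.π B = u + d • v := by
  have hev : ∀ᶠ s in nhdsWithin d (Iio d), 0 ≤ s ∧ s < d := by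
    filter_upwards [self_mem_nhdsWithin, nhdsWithin_le_nhds (lt_mem_nhds hd)] with s h1 h2
    exact ⟨h2.le, h1⟩
  have h1 : Tendsto (fun s : ℝ => dist (u + s • v) (W.π B)) (nhdsWithin d (Iio d))
      (nhds (dist (u + d • v) (W.π B))) := by
    have : Continuous fun s : ℝ => dist (u + s • v) (W.π B) := by fun_prop
    exact (this.tendsto d).mono_left nhdsWithin_le_nhds
  have h2 : Tendsto (fun s : ℝ => d - s) (nhdsWithin d (Iio d)) (nhds (d - d)) := by
    have : Continuous fun s : ℝ => d - s := by fun_prop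
    exact (this.tendsto d).mono_left nhdsWithin_le_nhds
  have := le_of_tendsto_of_tendsto h1 h2 (by
    filter_upwards [hev] with s hs
    have h3 := h s hs.1 hs.2
    have h4 := dist_π_le (W.ι (u + s • v)) B
    rw [π_ι (h3.1 (right_mem_segment ℝ _ _))] at h4
    exact h4.trans h3.2)
  rw [sub_self] at this
  exact (dist_le_zero.1 this).symm

theorem Edge.map {U V : Dom n} (f : BdIso U V) {a b : U.X} (h : Edge a b) :
    Edge (f.F a) (f.F b) := by
  obtain ⟨u, hu, hu1, hu2⟩ := exists_mid f h
  set d := dist a b with hd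
  have hdpos : 0 < d := by rw [hd, h.dist_eq]; exact dist_pos.2 h.ne
  have hno : ∀ C : V.X, Bd C → ∀ T, 0 < T → T < d → dist (f.F a) C ≤ T →
      dist C (f.F b) ≤ d - T → False := fun C hC T h1 h2 h3 h4 =>
    h.no_bd_between f hC h1 h2 h3 h4
  have hBA := f.F_bd h.bd_left
  have hBB := f.F_bd h.bd_right
  have hAB : dist (f.F a) (f.F b) = d := f.F_dist h.bd_left h.bd_right
  generalize f.F a = A at *
  generalize f.F b = B at *
  obtain ⟨r, hr, -, hball⟩ := exists_closedBall_subset hu one_pos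
  obtain ⟨z, hz, hzB⟩ := exists_step hBB hr hball
  obtain ⟨w, hw, hwA⟩ := exists_step hBA hr hball
  have hop := opposite_steps (A := A) (B := B) (a := d / 2) (b := d / 2) hball
    (by rw [hAB]; linarith) hw hz
    (by rw [dist_comm]; rw [dist_comm] at hu1; linarith) (by linarith)
  set v := (1 / r) • (z - u) with hv
  have hvn : ‖v‖ = 1 := by
    rw [hv, norm_smul, ← dist_eq_norm, hz, Real.norm_eq_abs, abs_of_pos (by positivity)]
    field_simp
  have hzv : z = u + r • v := by
    rw [hv, smul_smul, mul_one_div_cancel hr.ne']; simp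
  have hwv : w = u + r • -v := by
    rw [hv, hop, smul_neg, smul_smul, mul_one_div_cancel hr.ne']; simp
  have hsegz : segment ℝ u z ⊆ V.carrier :=
    ((convex_closedBall u r).segment_subset (mem_closedBall_self hr.le) hz.le).trans hball
  have hsegw : segment ℝ u w ⊆ V.carrier :=
    ((convex_closedBall u r).segment_subset (mem_closedBall_self hr.le) hw.le).trans hball
  have R1 := ray_prolong hBB hAB (half_pos hdpos) hno hvn hu1 hr (by rwa [← hzv])
    (by rw [← hzv]; linarith)
  have R2 := ray_prolong hBA (d := d) (by rw [dist_comm, hAB]) (half_pos hdpos)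
    (fun C hC T h1 h2 h3 h4 => hno C hC (d - T) (by linarith) (by linarith)
      (by rwa [dist_comm]) (by rw [dist_comm]; linarith)) (v := -v) (by rw [norm_neg, hvn])
    (by rwa [dist_comm]) hr (by rwa [← hwv]) (by rw [← hwv]; rw [dist_comm] at hu1; linarith)
  have hdd : d - d / 2 = d / 2 := by ring
  rw [hdd] at R1 R2
  have hπB := support_of_ray (half_pos hdpos) R1
  have hπA := support_of_ray (half_pos hdpos) R2
  have hne : V.π A ≠ V.π B := by
    intro he
    rw [hπA, hπB] at he
    have : d • v = 0 := by
      have h0 : u + (d / 2) • v - (u + (d / 2) • -v) = 0 := by rw [he, sub_self]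
      rw [← h0]; module
    rw [smul_eq_zero] at this
    rcases this with h0 | h0
    · linarith
    · rw [h0, norm_zero] at hvn; linarith
  have main : ∀ p ∈ openSegment ℝ (V.π A) (V.π B), p ∈ V.carrier ∧
      dist (V.ι p) A ≤ dist p (V.π A) ∧ dist (V.ι p) B ≤ dist p (V.π B) := by
    intro p hp
    rw [openSegment_eq_image'] at hp
    obtain ⟨t, ht, rfl⟩ := hp
    set s := t * d - d / 2 with hs
    have ht0 := mul_pos ht.1 hdpos
    have ht1 : t * d < d := by nlinarith [ht.2]
    have hp : V.π A + t • (V.π B - V.π A) = u + s • v := by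
      rw [hπA, hπB, hs]; module
    have hp' : u + s • v = u + (-s) • -v := by module
    have dA : dist (u + s • v) (V.π A) = t * d := by
      rw [hπA, smul_neg, ← neg_smul, dist_ray hvn, abs_of_nonneg (by linarith), hs]; ring
    have dB : dist (u + s • v) (V.π B) = d - t * d := by
      rw [hπB, dist_ray hvn, abs_of_nonpos (by linarith), hs]; ring
    beta_reduce
    rw [hp, dA, dB]
    rcases le_total 0 s with h0 | h0
    · obtain ⟨h1, h2⟩ := R1 s h0 (by linarith)
      have h3 := dist_ι_of_segment h1
      rw [dist_ray_zero hvn h0] at h3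
      refine ⟨h1 (right_mem_segment ℝ _ _), ?_, by linarith⟩
      have := dist_triangle A (V.ι u) (V.ι (u + s • v))
      rw [dist_comm]; linarith
    · obtain ⟨h1, h2⟩ := R2 (-s) (by linarith) (by linarith)
      rw [← hp'] at h1 h2
      have h3 := dist_ι_of_segment h1
      have h4 : dist u (u + s • v) = -s := by
        rw [hp']; exact dist_ray_zero (by rw [norm_neg, hvn]) (by linarith)
      rw [h4] at h3
      refine ⟨h1 (right_mem_segment ℝ _ _), by linarith, ?_⟩
      have := dist_triangle_left (V.ι (u + s • v)) B (V.ι u)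
      linarith
  exact ⟨hBA, hBB, hne, ⟨fun p hp => (main p hp).1, fun p hp => (main p hp).2.1⟩,
    ⟨fun p hp => (main p hp).1, fun p hp => (main p hp).2.2⟩⟩

theorem Edge.map_dist {U V : Dom n} (f : BdIso U V) {a b : U.X} (h : Edge a b) :
    dist (V.π (f.F a)) (V.π (f.F b)) = dist (U.π a) (U.π b) := by
  rw [← (h.map f).dist_eq, f.F_dist h.bd_left h.bd_right, h.dist_eq]

end Dom

namespace Dom
variable {n : ℕ}

theorem sum_dist_sq {I : Type*} [Fintype I] {lam : I → ℝ} (hl : ∑ i, lam i = 1) (p : I → Euc n)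
    (q : Euc n) : ∑ i, lam i * dist (p i) q ^ 2 =
      dist (∑ i, lam i • p i) q ^ 2 + ∑ i, lam i * dist (p i) (∑ i, lam i • p i) ^ 2 := by
  set P := ∑ i, lam i • p i with hP
  have key : ∀ i, dist (p i) q ^ 2 = dist (p i) P ^ 2 + 2 * inner ℝ (p i - P) (P - q) +
      dist P q ^ 2 := by
    intro i
    rw [dist_eq_norm, dist_eq_norm, dist_eq_norm, ← norm_add_sq_real]
    congr 2; abel
  have h0 : ∑ i, lam i * inner ℝ (p i - P) (P - q) = 0 := by
    simp_rw [← real_inner_smul_left]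
    rw [← sum_inner]
    have : ∑ i, lam i • (p i - P) = 0 := by
      simp_rw [smul_sub]
      rw [Finset.sum_sub_distrib, ← Finset.sum_smul, hl, one_smul, ← hP, sub_self]
    rw [this, inner_zero_left]
  calc ∑ i, lam i * dist (p i) q ^ 2 = ∑ i, (lam i * dist (p i) P ^ 2 +
        2 * (lam i * inner ℝ (p i - P) (P - q)) + lam i * dist P q ^ 2) := by
        refine Finset.sum_congr rfl fun i _ => ?_
        rw [key]; ring
    _ = _ := by
        rw [Finset.sum_add_distrib, Finset.sum_add_distrib, ← Finset.mul_sum, h0,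
          ← Finset.sum_mul, hl]; ring

theorem sum_sum_dist_sq {I J : Type*} [Fintype I] [Fintype J] {lam : I → ℝ} {mu : J → ℝ}
    (hl : ∑ i, lam i = 1) (hm : ∑ j, mu j = 1) (p : I → Euc n) (q : J → Euc n) :
    ∑ i, ∑ j, lam i * mu j * dist (p i) (q j) ^ 2 =
      dist (∑ i, lam i • p i) (∑ j, mu j • q j) ^ 2 +
      ∑ i, lam i * dist (p i) (∑ i, lam i • p i) ^ 2 +
      ∑ j, mu j * dist (q j) (∑ j, mu j • q j) ^ 2 := by
  have h1 : ∀ i, ∑ j, lam i * mu j * dist (p i) (q j) ^ 2 =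
      lam i * dist (p i) (∑ j, mu j • q j) ^ 2 +
      lam i * ∑ j, mu j * dist (q j) (∑ j, mu j • q j) ^ 2 := by
    intro i
    rw [← mul_add, dist_comm (p i), ← sum_dist_sq hm, Finset.mul_sum]
    refine Finset.sum_congr rfl fun j _ => ?_
    rw [dist_comm]; ring
  simp_rw [h1]
  rw [Finset.sum_add_distrib, ← Finset.sum_mul, hl, sum_dist_sq hl]
  ring

/-- Variances agree for families with the same mutual distances. -/
theorem variance_congr {I : Type*} [Fintype I] {lam : I → ℝ} (hl : ∑ i, lam i = 1)
    {p q : I → Euc n} (h : ∀ i j, dist (p i) (p j) = dist (q i) (q j)) :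
    ∑ i, lam i * dist (p i) (∑ i, lam i • p i) ^ 2 =
      ∑ i, lam i * dist (q i) (∑ i, lam i • q i) ^ 2 := by
  have h1 := sum_sum_dist_sq hl hl p p
  have h2 := sum_sum_dist_sq hl hl q q
  simp_rw [h] at h1
  simp only [dist_self] at h1 h2
  linarith

theorem dist_sq_affine (a b c : Euc n) (t : ℝ) :
    dist ((1 - t) • a + t • b) c ^ 2 =
      (1 - t) * dist a c ^ 2 + t * dist b c ^ 2 - t * (1 - t) * dist a b ^ 2 := by
  have e1 : (1 - t) • a + t • b - c = (1 - t) • (a - c) + t • (b - c) := by module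
  have e2 : a - b = (a - c) - (b - c) := by abel
  simp only [dist_eq_norm]
  rw [e1, e2, norm_add_sq_real, norm_sub_sq_real (a - c) (b - c), norm_smul, norm_smul,
    real_inner_smul_left,
    real_inner_smul_right, mul_pow, mul_pow, Real.norm_eq_abs, Real.norm_eq_abs, sq_abs, sq_abs]
  ring

/-- The detour between points of two overlapping balls is controlled by their powers. -/
theorem exists_detour {m m' a b o : Euc n} {R R' δ L : ℝ} (hR : 0 ≤ R) (hR' : 0 ≤ R') (hδ : 0 < δ)
    (ha : dist a m = R) (hb : dist b m' = R') (ha' : R' ≤ dist a m') (hb' : R ≤ dist b m)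
    (ho : dist o m ^ 2 - R ^ 2 ≤ -δ) (ho' : dist o m' ^ 2 - R' ^ 2 ≤ -δ)
    (hLa : dist a o ≤ L) (hLb : dist b o ≤ L) :
    ∃ q, dist q m ≤ R ∧ dist q m' ≤ R' ∧ (dist q a + dist q b) ^ 2 ≤ dist a b ^ 2 +
      L ^ 2 / δ ^ 2 * ((dist a m' ^ 2 - R' ^ 2) * (dist b m ^ 2 - R ^ 2)) := by
  set α := dist a m' ^ 2 - R' ^ 2 with hα
  set β := dist b m ^ 2 - R ^ 2 with hβ
  have hα0 : 0 ≤ α := by rw [hα]; nlinarith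
  have hβ0 : 0 ≤ β := by rw [hβ]; nlinarith
  have hL : 0 ≤ L := dist_nonneg.trans hLa
  obtain ⟨t, ht0, ht1, hts⟩ : ∃ t : ℝ, 0 ≤ t ∧ t ≤ 1 ∧ t * β = (1 - t) * α := by
    rcases (add_nonneg hα0 hβ0).eq_or_lt with h | h
    · exact ⟨0, le_rfl, zero_le_one, by nlinarith⟩
    · refine ⟨α / (α + β), by positivity, div_le_one_of_le₀ (by linarith) h.le, ?_⟩
      field_simp; ring
  set q0 := (1 - t) • a + t • b with hq0
  have hP := dist_sq_affine a b m t
  have hP' := dist_sq_affine a b m' t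
  rw [← hq0] at hP hP'
  set s := t * β - t * (1 - t) * dist a b ^ 2 with hs
  have hPs : dist q0 m ^ 2 - R ^ 2 = s := by rw [hP, hs, hβ, ha]; ring
  have hPs' : dist q0 m' ^ 2 - R' ^ 2 = s := by rw [hP', hs, hts, hα, hb]; ring
  have hqa : dist q0 a = t * dist a b := by
    rw [dist_eq_norm, hq0, show (1 - t) • a + t • b - a = t • (b - a) by module, norm_smul,
      Real.norm_eq_abs, abs_of_nonneg ht0, dist_comm, dist_eq_norm]
  have hqb : dist q0 b = (1 - t) * dist a b := by
    rw [dist_eq_norm, hq0, show (1 - t) • a + t • b - b = (1 - t) • (a - b) by module, norm_smul,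
      Real.norm_eq_abs, abs_of_nonneg (by linarith), dist_eq_norm]
  rcases le_or_gt s 0 with h | h
  · refine ⟨q0, abs_le_of_sq_le_sq' (by linarith) hR |>.2,
      abs_le_of_sq_le_sq' (by linarith) hR' |>.2, ?_⟩
    rw [hqa, hqb]
    have : 0 ≤ L ^ 2 / δ ^ 2 * (α * β) := by positivity
    nlinarith
  · have ht0' : 0 < t := ht0.lt_of_ne (by rintro rfl; simp [hs] at h)
    have hs2 : s ≤ t * β := by
      have := mul_nonneg (mul_nonneg ht0 (sub_nonneg.2 ht1)) (sq_nonneg (dist a b))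
      linarith
    have ht1' : t < 1 := ht1.lt_of_ne (by rintro rfl; linarith)
    have hs3 : s ^ 2 ≤ t * (1 - t) * (α * β) := by
      calc s ^ 2 = s * s := sq s
        _ ≤ (t * β) * ((1 - t) * α) := mul_le_mul hs2 (hs2.trans hts.le) h.le (by positivity)
        _ = _ := by ring
    set τ := s / (s + δ) with hτ
    have hτ0 : 0 ≤ τ := by positivity
    have hτ1 : τ ≤ 1 := div_le_one_of_le₀ (by linarith) (by positivity)
    have hτe : (1 - τ) * s = τ * δ := by rw [hτ]; field_simp; ring
    have hτs : τ ≤ s / δ := by rw [hτ]; gcongr; linarith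
    set q := (1 - τ) • q0 + τ • o with hq
    have A : ∀ (m : Euc n) (R : ℝ), 0 ≤ R → dist q0 m ^ 2 - R ^ 2 = s →
        dist o m ^ 2 - R ^ 2 ≤ -δ → dist q m ≤ R := by
      intro m R hR h1 h2
      refine abs_le_of_sq_le_sq' ?_ hR |>.2
      rw [hq, dist_sq_affine]
      have := mul_nonneg (mul_nonneg hτ0 (sub_nonneg.2 hτ1)) (sq_nonneg (dist q0 o))
      have h3 := mul_le_mul_of_nonneg_left h2 hτ0
      have h4 : (1 - τ) * dist q0 m ^ 2 = (1 - τ) * (s + R ^ 2) := by rw [← h1]; ring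
      linarith
    have hoq : dist q0 o ≤ L := by
      refine abs_le_of_sq_le_sq' ?_ hL |>.2
      rw [hq0, dist_sq_affine]
      have := mul_nonneg (mul_nonneg ht0 (sub_nonneg.2 ht1)) (sq_nonneg (dist a b))
      have h1 := mul_le_mul_of_nonneg_left (pow_le_pow_left₀ dist_nonneg hLa 2) (sub_nonneg.2 ht1)
      have h2 := mul_le_mul_of_nonneg_left (pow_le_pow_left₀ dist_nonneg hLb 2) ht0
      linarith
    set e := τ • (o - q0) with he
    have hqe : q = q0 + e := by rw [hq, he]; module
    have hen : ‖e‖ ^ 2 ≤ L ^ 2 / δ ^ 2 * s ^ 2 := by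
      have : ‖e‖ ≤ s / δ * L := by
        rw [he, norm_smul, Real.norm_eq_abs, abs_of_nonneg hτ0, ← dist_eq_norm, dist_comm]
        exact mul_le_mul hτs hoq dist_nonneg (by positivity)
      calc ‖e‖ ^ 2 ≤ (s / δ * L) ^ 2 := pow_le_pow_left₀ (norm_nonneg _) this 2
        _ = _ := by ring
    refine ⟨q, A m R hR hPs ho, A m' R' hR' hPs' ho', ?_⟩
    have d1 : dist q a ^ 2 = t ^ 2 * dist a b ^ 2 + 2 * t * inner ℝ (b - a) e + ‖e‖ ^ 2 := by
      rw [dist_eq_norm, hqe, show q0 + e - a = t • (b - a) + e by rw [hq0]; module,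
        norm_add_sq_real, norm_smul, real_inner_smul_left, mul_pow, Real.norm_eq_abs, sq_abs,
        dist_comm, dist_eq_norm]; ring
    have d2 : dist q b ^ 2 = (1 - t) ^ 2 * dist a b ^ 2 - 2 * (1 - t) * inner ℝ (b - a) e +
        ‖e‖ ^ 2 := by
      have h2 : ‖(1 - t) • (b - a)‖ ^ 2 = (1 - t) ^ 2 * dist a b ^ 2 := by
        rw [norm_smul, mul_pow, Real.norm_eq_abs, sq_abs, dist_comm, dist_eq_norm]
      rw [dist_eq_norm, hqe, show q0 + e - b = e - (1 - t) • (b - a) by rw [hq0]; module,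
        norm_sub_sq_real, h2, real_inner_smul_right, real_inner_comm]; ring
    have hw : 0 < t * (1 - t) := mul_pos ht0' (by linarith)
    have cs : t * (1 - t) * (dist q a + dist q b) ^ 2 ≤
        (1 - t) * dist q a ^ 2 + t * dist q b ^ 2 := by
      have h1 := sq_nonneg ((1 - t) * dist q a - t * dist q b)
      have h2 : (1 - t) * dist q a ^ 2 + t * dist q b ^ 2 - t * (1 - t) * (dist q a + dist q b) ^ 2
        = ((1 - t) * dist q a - t * dist q b) ^ 2 := by ring
      linarith
    have cs2 : (1 - t) * dist q a ^ 2 + t * dist q b ^ 2 =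
        t * (1 - t) * dist a b ^ 2 + ‖e‖ ^ 2 := by
      rw [d1, d2]
      generalize inner ℝ (b - a) e = A
      generalize ‖e‖ = B
      generalize dist a b = C
      ring
    have key : ‖e‖ ^ 2 ≤ L ^ 2 / δ ^ 2 * (t * (1 - t) * (α * β)) :=
      hen.trans (mul_le_mul_of_nonneg_left hs3 (by positivity))
    refine le_of_mul_le_mul_left ?_ hw
    calc t * (1 - t) * (dist q a + dist q b) ^ 2 ≤ _ := cs
      _ = _ := cs2
      _ ≤ t * (1 - t) * dist a b ^ 2 + L ^ 2 / δ ^ 2 * (t * (1 - t) * (α * β)) :=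
        add_le_add_right key _
      _ = _ := by
        generalize L ^ 2 / δ ^ 2 = K
        generalize dist a b = C
        generalize α = A
        generalize β = B
        ring

end Dom

namespace Dom
variable {n : ℕ} {W : Dom n}

/-- A map on boundary points that is `1`-Lipschitz and preserves the lengths of boundary
intervals. -/
structure Good (φ : W.X → Euc n) : Prop where
  lip : ∀ ξ ζ, Bd ξ → Bd ζ → dist (φ ξ) (φ ζ) ≤ dist ξ ζ
  edge : ∀ ξ ζ, Edge ξ ζ → dist (φ ξ) (φ ζ) = dist (W.π ξ) (W.π ζ)

/-- A simplex of boundary points inscribed in a sphere bounding a ball inside the domain, with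
`w` in its relative interior. -/
structure Cell (W : Dom n) (w : Euc n) where
  I : Type
  fin : Fintype I
  m : Euc n
  R : ℝ
  lam : I → ℝ
  ξ : I → W.X
  R_pos : 0 < R
  ball_subset : ball m R ⊆ W.carrier
  bd : ∀ i, Bd (ξ i)
  sees : ∀ i, Sees (ball m R) (ξ i)
  dist_m : ∀ i, dist (W.π (ξ i)) m = R
  lam_pos : ∀ i, 0 < lam i
  sum_lam : ∑ i, lam i = 1
  sum_smul : ∑ i, lam i • W.π (ξ i) = w
  indep : AffineIndependent ℝ fun i => W.π (ξ i)
  mem : w ∈ ball m R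

attribute [instance] Cell.fin

theorem openSegment_subset_ball {m o q : Euc n} {R : ℝ} (hR : 0 < R) (ho : o ∈ ball m R)
    (hq : dist q m ≤ R) : openSegment ℝ o q ⊆ ball m R := by
  have := (convex_ball m R).openSegment_interior_closure_subset_interior (x := o) (y := q)
    (by rwa [isOpen_ball.interior_eq]) (by rwa [closure_ball _ hR.ne'])
  rwa [isOpen_ball.interior_eq] at this

theorem openSegment_subset_ball_of_ne {m p q : Euc n} {R : ℝ} (hp : dist p m ≤ R)
    (hq : dist q m ≤ R) (h : p ≠ q) : openSegment ℝ p q ⊆ ball m R := by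
  rcases eq_or_ne R 0 with rfl | hR
  · exact absurd ((dist_le_zero.1 hp).trans (dist_le_zero.1 hq).symm) h
  · have := (strictConvex_closedBall ℝ m R).openSegment_subset hp hq h
    rwa [interior_closedBall _ hR] at this

namespace Cell
variable {w w' : Euc n}

theorem edge (c : Cell W w) {i j : c.I} (h : i ≠ j) : Edge (c.ξ i) (c.ξ j) := by
  have hne : W.π (c.ξ i) ≠ W.π (c.ξ j) := fun e => h (c.indep.injective e)
  have hs := openSegment_subset_ball_of_ne (c.dist_m i).le (c.dist_m j).le hne
  exact ⟨c.bd i, c.bd j, hne, (c.sees i).mono hs, (c.sees j).mono hs⟩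

/-- The value at `w` of the affine interpolation of `φ` over the cell. -/
def val (c : Cell W w) (φ : W.X → Euc n) : Euc n := ∑ i, c.lam i • φ (c.ξ i)

theorem sum_dist_π_sq (c : Cell W w) (q : Euc n) :
    ∑ i, c.lam i * dist (W.π (c.ξ i)) q ^ 2 =
      dist w q ^ 2 + ∑ i, c.lam i * dist (W.π (c.ξ i)) w ^ 2 := by
  have := sum_dist_sq c.sum_lam (fun i => W.π (c.ξ i)) q
  rwa [c.sum_smul] at this

theorem variance (c : Cell W w) :
    ∑ i, c.lam i * dist (W.π (c.ξ i)) w ^ 2 = c.R ^ 2 - dist w c.m ^ 2 := by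
  have := c.sum_dist_π_sq c.m
  simp_rw [c.dist_m] at this
  rw [← Finset.sum_mul, c.sum_lam] at this
  linarith

theorem variance_φ (c : Cell W w) {φ : W.X → Euc n} (hφ : Good φ) :
    ∑ i, c.lam i * dist (φ (c.ξ i)) (c.val φ) ^ 2 = c.R ^ 2 - dist w c.m ^ 2 := by
  have := variance_congr c.sum_lam (p := fun i => φ (c.ξ i)) (q := fun i => W.π (c.ξ i)) ?_
  · rw [c.sum_smul, c.variance] at this
    exact this
  · intro i j
    rcases eq_or_ne i j with rfl | h
    · simp
    · exact hφ.edge _ _ (c.edge h)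

theorem R_le_dist (c : Cell W w) {ξ : W.X} (h : Bd ξ) : c.R ≤ dist (W.π ξ) c.m :=
  not_lt.1 fun h' => h.π_notMem (c.ball_subset h')

theorem dist_φ_le (c : Cell W w) (c' : Cell W w') {φ : W.X → Euc n} (hφ : Good φ) {o : Euc n}
    {δ L : ℝ} (hδ : 0 < δ) (ho : dist o c.m ^ 2 - c.R ^ 2 ≤ -δ)
    (ho' : dist o c'.m ^ 2 - c'.R ^ 2 ≤ -δ) (hL : ∀ i, dist (W.π (c.ξ i)) o ≤ L)
    (hL' : ∀ i, dist (W.π (c'.ξ i)) o ≤ L) (i : c.I) (j : c'.I) :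
    dist (φ (c.ξ i)) (φ (c'.ξ j)) ^ 2 ≤ dist (W.π (c.ξ i)) (W.π (c'.ξ j)) ^ 2 +
      L ^ 2 / δ ^ 2 * ((dist (W.π (c.ξ i)) c'.m ^ 2 - c'.R ^ 2) *
        (dist (W.π (c'.ξ j)) c.m ^ 2 - c.R ^ 2)) := by
  obtain ⟨q, h1, h2, h3⟩ := exists_detour c.R_pos.le c'.R_pos.le hδ (c.dist_m i) (c'.dist_m j)
    (c'.R_le_dist (c.bd i)) (c.R_le_dist (c'.bd j)) ho ho' (hL i) (hL' j)
  refine le_trans (pow_le_pow_left₀ dist_nonneg ?_ 2) h3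
  refine (hφ.lip _ _ (c.bd i) (c'.bd j)).trans (dist_le_of_sees (c.sees i) (c'.sees j) ?_)
  have hob : o ∈ ball c.m c.R := abs_lt_of_sq_lt_sq' (by linarith) c.R_pos.le |>.2
  have hob' : o ∈ ball c'.m c'.R := abs_lt_of_sq_lt_sq' (by linarith) c'.R_pos.le |>.2
  have : openSegment ℝ o q ⊆ ball c.m c.R ∩ ball c'.m c'.R :=
    subset_inter (openSegment_subset_ball c.R_pos hob h1) (openSegment_subset_ball c'.R_pos hob' h2)
  refine closure_mono this ?_
  rw [closure_openSegment]
  exact right_mem_segment _ _ _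

theorem dist_val_sq_le (c : Cell W w) (c' : Cell W w') {φ : W.X → Euc n} (hφ : Good φ) {o : Euc n}
    {δ L : ℝ} (hδ : 0 < δ) (ho : dist o c.m ^ 2 - c.R ^ 2 ≤ -δ)
    (ho' : dist o c'.m ^ 2 - c'.R ^ 2 ≤ -δ) (hL : ∀ i, dist (W.π (c.ξ i)) o ≤ L)
    (hL' : ∀ i, dist (W.π (c'.ξ i)) o ≤ L) :
    dist (c.val φ) (c'.val φ) ^ 2 ≤
      (1 + L ^ 2 / δ ^ 2 * dist c.m c'.m ^ 2) * dist w w' ^ 2 := by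
  have e1 := sum_sum_dist_sq c.sum_lam c'.sum_lam (fun i => φ (c.ξ i)) (fun j => φ (c'.ξ j))
  have e2 := sum_sum_dist_sq c.sum_lam c'.sum_lam (fun i => W.π (c.ξ i)) (fun j => W.π (c'.ξ j))
  have v1 := c.variance_φ hφ
  have v2 := c'.variance_φ hφ
  unfold val at v1 v2
  rw [v1, v2] at e1
  rw [c.sum_smul, c'.sum_smul, c.variance, c'.variance] at e2
  set A := ∑ i, c.lam i * (dist (W.π (c.ξ i)) c'.m ^ 2 - c'.R ^ 2) with hA
  set B := ∑ j, c'.lam j * (dist (W.π (c'.ξ j)) c.m ^ 2 - c.R ^ 2) with hB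
  have hle : ∑ i, ∑ j, c.lam i * c'.lam j * dist (φ (c.ξ i)) (φ (c'.ξ j)) ^ 2 ≤
      ∑ i, ∑ j, c.lam i * c'.lam j * dist (W.π (c.ξ i)) (W.π (c'.ξ j)) ^ 2 +
        L ^ 2 / δ ^ 2 * (A * B) := by
    rw [hA, hB, Finset.sum_mul_sum, Finset.mul_sum, ← Finset.sum_add_distrib]
    refine Finset.sum_le_sum fun i _ => ?_
    rw [Finset.mul_sum, ← Finset.sum_add_distrib]
    refine Finset.sum_le_sum fun j _ => ?_
    have := mul_le_mul_of_nonneg_left (c.dist_φ_le c' hφ hδ ho ho' hL hL' i j)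
      (mul_pos (c.lam_pos i) (c'.lam_pos j)).le
    refine this.trans_eq ?_
    ring
  have hA1 : A = dist w c'.m ^ 2 + (c.R ^ 2 - dist w c.m ^ 2) - c'.R ^ 2 := by
    simp_rw [hA, mul_sub]
    rw [Finset.sum_sub_distrib, c.sum_dist_π_sq, c.variance, ← Finset.sum_mul, c.sum_lam, one_mul]
  have hB1 : B = dist w' c.m ^ 2 + (c'.R ^ 2 - dist w' c'.m ^ 2) - c.R ^ 2 := by
    simp_rw [hB, mul_sub]
    rw [Finset.sum_sub_distrib, c'.sum_dist_π_sq, c'.variance, ← Finset.sum_mul, c'.sum_lam,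
      one_mul]
  have hA0 : 0 ≤ A := Finset.sum_nonneg fun i _ => mul_nonneg (c.lam_pos i).le <|
    sub_nonneg.2 (pow_le_pow_left₀ c'.R_pos.le (c'.R_le_dist (c.bd i)) 2)
  have hB0 : 0 ≤ B := Finset.sum_nonneg fun i _ => mul_nonneg (c'.lam_pos i).le <|
    sub_nonneg.2 (pow_le_pow_left₀ c.R_pos.le (c.R_le_dist (c'.bd i)) 2)
  have hAB : A + B = 2 * inner ℝ (w - w') (c.m - c'.m) := by
    rw [hA1, hB1]
    simp only [dist_eq_norm, ← real_inner_self_eq_norm_sq, inner_sub_left, inner_sub_right]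
    rw [real_inner_comm c.m w, real_inner_comm c'.m w, real_inner_comm c.m w',
      real_inner_comm c'.m w']
    ring
  have hABle : A * B ≤ dist c.m c'.m ^ 2 * dist w w' ^ 2 := by
    have h1 : A + B ≤ 2 * (dist c.m c'.m * dist w w') := by
      rw [hAB, dist_eq_norm, dist_eq_norm, mul_comm ‖c.m - c'.m‖]
      exact mul_le_mul_of_nonneg_left (real_inner_le_norm _ _) zero_le_two
    have h2 : (A + B) ^ 2 ≤ (2 * (dist c.m c'.m * dist w w')) ^ 2 :=
      pow_le_pow_left₀ (by linarith) h1 2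
    have h3 := sq_nonneg (A - B)
    linarith [show (A + B) ^ 2 = (A - B) ^ 2 + 4 * (A * B) by ring,
      show (2 * (dist c.m c'.m * dist w w')) ^ 2 = 4 * (dist c.m c'.m ^ 2 * dist w w' ^ 2) by ring]
  have hk := mul_le_mul_of_nonneg_left hABle (show 0 ≤ L ^ 2 / δ ^ 2 by positivity)
  unfold val
  linarith

theorem val_eq (c c' : Cell W w) {φ : W.X → Euc n} (hφ : Good φ) : c.val φ = c'.val φ := by
  have h1 : 0 < c.R ^ 2 - dist w c.m ^ 2 :=
    sub_pos.2 (pow_lt_pow_left₀ c.mem dist_nonneg two_ne_zero)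
  have h2 : 0 < c'.R ^ 2 - dist w c'.m ^ 2 :=
    sub_pos.2 (pow_lt_pow_left₀ c'.mem dist_nonneg two_ne_zero)
  have hb : ∀ {m : Euc n} {R : ℝ} {a : Euc n}, dist a m = R → w ∈ ball m R → dist a w ≤ 2 * R := by
    intro m R a h h'
    have := dist_triangle_right a w m
    have : dist w m < R := h'
    linarith
  have := c.dist_val_sq_le c' hφ (o := w) (lt_min h1 h2) (L := max (2 * c.R) (2 * c'.R))
    (by linarith [min_le_left (c.R ^ 2 - dist w c.m ^ 2) (c'.R ^ 2 - dist w c'.m ^ 2)])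
    (by linarith [min_le_right (c.R ^ 2 - dist w c.m ^ 2) (c'.R ^ 2 - dist w c'.m ^ 2)])
    (fun i => (hb (c.dist_m i) c.mem).trans (le_max_left _ _))
    (fun i => (hb (c'.dist_m i) c'.mem).trans (le_max_right _ _))
  rw [dist_self, zero_pow two_ne_zero, mul_zero] at this
  exact dist_eq_zero.1 (pow_eq_zero_iff two_ne_zero |>.1 (this.antisymm (sq_nonneg _)))

end Cell

end Dom

namespace Dom
variable {n : ℕ} {W : Dom n}

/-- The power-type functional whose maximizers are centers of cells over `w`. -/
def pow (W : Dom n) (w m : Euc n) : ℝ := infDist m W.carrierᶜ ^ 2 - dist m w ^ 2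

theorem continuous_pow : Continuous fun p : Euc n × Euc n => W.pow p.1 p.2 := by
  unfold pow
  have := (continuous_infDist_pt W.carrierᶜ).comp (continuous_snd (X := Euc n) (Y := Euc n))
  exact (this.pow 2).sub ((continuous_snd.dist continuous_fst).pow 2)

/-- `w` lies well inside the convex hull of a bounded part of the complement. -/
structure Deep (W : Dom n) (S : Set (Euc n)) (r C : ℝ) (w : Euc n) : Prop where
  r_pos : 0 < r
  subset : S ⊆ W.carrierᶜ
  ball : closedBall w r ⊆ convexHull ℝ S
  dist_le : ∀ s ∈ S, ∀ p ∈ convexHull ℝ S, dist s p ≤ C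

variable {S : Set (Euc n)} {r C : ℝ} {w m : Euc n}

theorem Deep.mem_hull (h : Deep W S r C w) : w ∈ convexHull ℝ S :=
  h.ball (mem_closedBall_self h.r_pos.le)

theorem Deep.nonempty (h : Deep W S r C w) : W.carrierᶜ.Nonempty :=
  (convexHull_nonempty_iff.1 ⟨w, h.mem_hull⟩).mono h.subset

theorem Deep.pow_le (h : Deep W S r C w) (m : Euc n) : W.pow w m ≤ C ^ 2 - 2 * r * dist m w := by
  set p := w + (r * ‖m - w‖⁻¹) • (m - w) with hp
  have hpm : p ∈ convexHull ℝ S := by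
    refine h.ball ?_
    rw [mem_closedBall, hp, dist_eq_norm, add_sub_cancel_left, norm_smul, Real.norm_eq_abs,
      abs_of_nonneg (mul_nonneg h.r_pos.le (by positivity)), mul_assoc]
    exact mul_le_of_le_one_right h.r_pos.le inv_mul_le_one
  obtain ⟨s, hs, hps⟩ := (((innerSL ℝ (m - w)).toLinearMap).convexOn
    (convex_convexHull ℝ S)).exists_ge_of_mem_convexHull (subset_convexHull ℝ S) hpm
  have hps' : inner ℝ (m - w) p ≤ inner ℝ (m - w) s := hps
  have h1 : inner ℝ (m - w) p = inner ℝ (m - w) w + r * ‖m - w‖ := by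
    rw [hp, inner_add_right, real_inner_smul_right, real_inner_self_eq_norm_sq]
    rcases eq_or_ne (‖m - w‖) 0 with h0 | h0
    · simp [h0]
    · field_simp
  have h2 : dist m s ^ 2 = dist m w ^ 2 - 2 * inner ℝ (m - w) (s - w) + dist s w ^ 2 := by
    rw [dist_eq_norm, dist_eq_norm, dist_eq_norm, ← norm_sub_sq_real]
    congr 2; abel
  have h3 : infDist m W.carrierᶜ ^ 2 ≤ dist m s ^ 2 :=
    pow_le_pow_left₀ infDist_nonneg (infDist_le_dist_of_mem (h.subset hs)) 2
  have h4 : dist s w ^ 2 ≤ C ^ 2 := pow_le_pow_left₀ dist_nonneg (h.dist_le s hs w h.mem_hull) 2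
  rw [inner_sub_right] at h2
  unfold pow
  rw [dist_eq_norm m w] at *
  linarith

theorem pow_self (h : Deep W S r C w) (hw : w ∈ W.carrier) : 0 < W.pow w w := by
  unfold pow
  rw [dist_self]
  have := infDist_pos h.nonempty hw
  rw [zero_pow two_ne_zero, sub_zero]
  positivity

theorem Deep.dist_le_of_pow_nonneg (h : Deep W S r C w) (hm : 0 ≤ W.pow w m) :
    dist m w ≤ C ^ 2 / (2 * r) := by
  have := h.pow_le m
  have hr := h.r_pos
  rw [le_div_iff₀ (by linarith)]
  linarith

theorem Deep.exists_max (h : Deep W S r C w) (hw : w ∈ W.carrier) :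
    ∃ m, ∀ m', W.pow w m' ≤ W.pow w m := by
  have hc : Continuous (W.pow w) := 
    ((continuous_infDist_pt W.carrierᶜ).pow 2).sub ((continuous_id.dist continuous_const).pow 2)
  have hr := h.r_pos
  have hw0 : w ∈ closedBall w (C ^ 2 / (2 * r)) := mem_closedBall_self (by positivity)
  obtain ⟨m, -, hm⟩ := (isCompact_closedBall w (C ^ 2 / (2 * r))).exists_isMaxOn
    ⟨w, hw0⟩ hc.continuousOn
  refine ⟨m, fun m' => ?_⟩
  have h0 : W.pow w w ≤ W.pow w m := hm hw0
  rcases le_total 0 (W.pow w m') with h' | h'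
  · exact hm (h.dist_le_of_pow_nonneg h')
  · linarith [pow_self h hw]

theorem isCompact_convexHull {K : Set (Euc n)} (hK : IsCompact K) : IsCompact (convexHull ℝ K) := by
  rcases K.eq_empty_or_nonempty with rfl | ⟨k0, hk0⟩
  · simp
  let g : (Fin (n + 1) → ℝ) × (Fin (n + 1) → Euc n) → Euc n := fun p => ∑ j, p.1 j • p.2 j
  have hg : Continuous g := by fun_prop
  have hc := ((isCompact_stdSimplex ℝ (Fin (n + 1))).prod
    (isCompact_univ_pi fun _ : Fin (n + 1) => hK)).image hg
  convert hc using 1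
  refine Subset.antisymm (fun x hx => ?_) ?_
  · obtain ⟨I, hI, z, lam, hz, hind, hpos, hsum, hsm⟩ := eq_pos_convex_span_of_mem_convexHull hx
    have hcard : Fintype.card I ≤ Fintype.card (Fin (n + 1)) := by
      have h1 := hind.card_le_finrank_succ
      have h2 := (vectorSpan ℝ (range z)).finrank_le
      rw [finrank_euclideanSpace_fin] at h2
      rw [Fintype.card_fin]
      lia
    obtain ⟨f⟩ := Function.Embedding.nonempty_of_card_le hcard
    have e1 : ∀ i, Function.extend f lam 0 (f i) = lam i := fun i => f.injective.extend_apply _ _ i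
    have e2 : ∀ i, Function.extend f z (fun _ => k0) (f i) = z i := fun i =>
      f.injective.extend_apply _ _ i
    have e3 : ∀ j, j ∉ range f → Function.extend f lam 0 j = 0 := fun j hj =>
      Function.extend_apply' _ _ _ hj
    refine ⟨(Function.extend f lam 0, Function.extend f z fun _ => k0), ⟨⟨fun j => ?_, ?_⟩, ?_⟩, ?_⟩
    · by_cases hj : j ∈ range f
      · obtain ⟨i, rfl⟩ := hj
        exact (hpos i).le.trans_eq (e1 i).symm
      · exact (e3 j hj).ge
    · rw [← hsum]
      exact (Fintype.sum_of_injective f f.injective _ _ e3 fun i => (e1 i).symm).symm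
    · intro j _
      by_cases hj : j ∈ range f
      · obtain ⟨i, rfl⟩ := hj
        change Function.extend f z (fun _ => k0) (f i) ∈ K
        rw [e2]
        exact hz (mem_range_self i)
      · change Function.extend f z (fun _ => k0) j ∈ K
        rwa [Function.extend_apply' _ _ _ hj]
    · change ∑ j, Function.extend f lam 0 j • Function.extend f z (fun _ => k0) j = x
      rw [← hsm]
      refine (Fintype.sum_of_injective f f.injective _ _ (fun j hj => ?_) fun i => ?_).symm
      · beta_reduce
        rw [e3 j hj, zero_smul]
      · beta_reduce
        rw [e1, e2]
  · rintro _ ⟨p, ⟨⟨h1, h2⟩, h3⟩, rfl⟩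
    exact (convex_convexHull ℝ K).sum_mem (fun j _ => h1 j) h2
      fun j _ => subset_convexHull ℝ K (h3 j (mem_univ j))

theorem mem_convexHull_contacts (hW : W.carrierᶜ.Nonempty) (hm : ∀ m', W.pow w m' ≤ W.pow w m) :
    w ∈ convexHull ℝ (W.carrierᶜ ∩ sphere m (infDist m W.carrierᶜ)) := by
  by_contra hw
  set K := W.carrierᶜ ∩ sphere m (infDist m W.carrierᶜ) with hK
  have hKc : IsCompact K := (isCompact_sphere _ _).inter_left W.isClosed_compl
  obtain ⟨f, u, hfw, hfK⟩ := geometric_hahn_banach_point_closed (convex_convexHull ℝ K)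
    (isCompact_convexHull hKc).isClosed hw
  obtain ⟨v, rfl⟩ := (InnerProductSpace.toDual ℝ (Euc n)).surjective f
  simp only [InnerProductSpace.toDual_apply_apply] at hfw hfK
  set e : ℕ → ℝ := fun j => 1 / ((j : ℝ) + 1) with he
  have he0 : ∀ j, 0 < e j := fun j => by rw [he]; positivity
  have he1 : ∀ j, e j ≤ 1 := fun j => by
    rw [he]; exact div_le_one_of_le₀ (by linarith [(Nat.cast_nonneg j : (0:ℝ) ≤ j)]) (by positivity)
  have hel : Tendsto e atTop (nhds 0) := tendsto_one_div_add_atTop_nhds_zero_nat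
  have hk : ∀ j, ∃ k ∈ W.carrierᶜ, infDist (m - e j • v) W.carrierᶜ = dist (m - e j • v) k :=
    fun j => W.isClosed_compl.exists_infDist_eq_dist hW _
  choose k hkW hkd using hk
  have hle : ∀ j, inner ℝ v (k j) ≤ inner ℝ v w := by
    intro j
    have h1 := hm (m - e j • v)
    unfold pow at h1
    rw [hkd] at h1
    have h2 : infDist m W.carrierᶜ ^ 2 ≤ dist m (k j) ^ 2 :=
      pow_le_pow_left₀ infDist_nonneg (infDist_le_dist_of_mem (hkW j)) 2
    have h3 : ∀ x, dist (m - e j • v) x ^ 2 = dist m x ^ 2 - 2 * (e j * inner ℝ v (m - x)) +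
        ‖e j • v‖ ^ 2 := by
      intro x
      rw [dist_eq_norm, dist_eq_norm, show m - e j • v - x = (m - x) - e j • v by abel,
        norm_sub_sq_real, real_inner_smul_right, real_inner_comm]
    rw [h3, h3, inner_sub_right, inner_sub_right] at h1
    have h4 : e j * inner ℝ v (k j) ≤ e j * inner ℝ v w := by linarith
    exact le_of_mul_le_mul_left h4 (he0 j)
  have hml : Tendsto (fun j => m - e j • v) atTop (nhds m) := by
    simpa using tendsto_const_nhds.sub (hel.smul_const v)
  have hbd : Bornology.IsBounded (range k) := by
    refine (isBounded_closedBall (x := m) (r := infDist m W.carrierᶜ + 2 * ‖v‖)).subset ?_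
    rintro _ ⟨j, rfl⟩
    have h1 := dist_triangle_left (k j) m (m - e j • v)
    have h2 : infDist (m - e j • v) W.carrierᶜ ≤ infDist m W.carrierᶜ + dist (m - e j • v) m :=
      infDist_le_infDist_add_dist
    have h3 : dist (m - e j • v) m ≤ ‖v‖ := by
      rw [dist_eq_norm, sub_sub_cancel_left, norm_neg, norm_smul, Real.norm_eq_abs,
        abs_of_pos (he0 j)]
      exact mul_le_of_le_one_left (norm_nonneg _) (he1 j)
    rw [mem_closedBall]
    rw [hkd] at h2
    linarith
  obtain ⟨a, -, ψ, hψ, hlim⟩ := tendsto_subseq_of_bounded hbd fun j => mem_range_self j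
  have haW : a ∈ W.carrierᶜ :=
    W.isClosed_compl.mem_of_tendsto hlim (Eventually.of_forall fun j => hkW _)
  have hda : infDist m W.carrierᶜ = dist m a := by
    have h1 := ((continuous_infDist_pt W.carrierᶜ).tendsto m).comp (hml.comp hψ.tendsto_atTop)
    have h2 := (hml.comp hψ.tendsto_atTop).dist hlim
    refine tendsto_nhds_unique h1 (h2.congr fun j => ?_)
    exact (hkd _).symm
  have h1 : u < inner ℝ v a :=
    hfK a (subset_convexHull ℝ K ⟨haW, by rw [mem_sphere, dist_comm, hda]⟩)
  have h2 : inner ℝ v a ≤ inner ℝ v w :=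
    le_of_tendsto' (tendsto_const_nhds.inner hlim) fun j => hle _
  linarith

/-- Every maximizer is the center of a cell. -/
theorem Deep.exists_cell (h : Deep W S r C w) (hw : w ∈ W.carrier)
    (hm : ∀ m', W.pow w m' ≤ W.pow w m) :
    ∃ c : Cell W w, c.m = m ∧ c.R = infDist m W.carrierᶜ := by
  have hpos : 0 < W.pow w m := (pow_self h hw).trans_le (hm w)
  have hlt : dist m w < infDist m W.carrierᶜ := by
    unfold pow at hpos
    exact abs_lt_of_sq_lt_sq' (by linarith) infDist_nonneg |>.2
  have hR : 0 < infDist m W.carrierᶜ := dist_nonneg.trans_lt hlt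
  obtain ⟨I, hI, z, lam, hz, hind, hpos', hsum, hsm⟩ :=
    eq_pos_convex_span_of_mem_convexHull (mem_convexHull_contacts h.nonempty hm)
  have hz' : ∀ i, z i ∉ W.carrier ∧ dist (z i) m = infDist m W.carrierᶜ := fun i =>
    ⟨(hz (mem_range_self i)).1, (hz (mem_range_self i)).2⟩
  have hsee := fun i => exists_sees_ball hR (ball_infDist_subset m) (hz' i).2.le (hz' i).1
  choose ξ hb hπ hs using hsee
  refine ⟨⟨I, hI, m, infDist m W.carrierᶜ, lam, ξ, hR, ball_infDist_subset m, hb, hs, fun i => ?_,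
    hpos', hsum, ?_, ?_, ?_⟩, rfl, rfl⟩
  · rw [hπ]; exact (hz' i).2
  · simpa only [hπ] using hsm
  · simpa only [hπ] using hind
  · rw [mem_ball, dist_comm]; exact hlt

theorem Deep.nonempty_cell (h : Deep W S r C w) (hw : w ∈ W.carrier) : Nonempty (Cell W w) := by
  obtain ⟨m, hm⟩ := h.exists_max hw
  obtain ⟨c, -⟩ := h.exists_cell hw hm
  exact ⟨c⟩

end Dom

namespace Dom

theorem segment_subset_insert_openSegment {n : ℕ} (w e : Euc n) {z : Euc n}
    (hz : z ∈ openSegment ℝ w e) : segment ℝ w z ⊆ insert w (openSegment ℝ w e) := by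
  rw [segment_eq_image']
  rintro _ ⟨t, ht, rfl⟩
  rw [openSegment_eq_image'] at hz ⊢
  obtain ⟨s, hs, rfl⟩ := hz
  rcases ht.1.eq_or_lt with rfl | h0
  · simp
  · refine Or.inr ⟨t * s, ⟨mul_pos h0 hs.1, ?_⟩, by module⟩
    exact (mul_le_of_le_one_left hs.1.le ht.2).trans_lt hs.2

variable {n : ℕ} {W : Dom n} {S : Set (Euc n)} {r C : ℝ} {w w₀ : Euc n}

/-- The extension of a map on boundary points by affine interpolation over cells. -/
def ext (W : Dom n) (φ : W.X → Euc n) (w : Euc n) : Euc n :=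
  open Classical in if h : Nonempty (Cell W w) then h.some.val φ else 0

theorem ext_eq {φ : W.X → Euc n} (hφ : Good φ) (c : Cell W w) : W.ext φ w = c.val φ := by
  have h : Nonempty (Cell W w) := ⟨c⟩
  unfold ext
  rw [dif_pos h]
  exact Cell.val_eq _ _ hφ

theorem Deep.near (h : Deep W S r C w₀) (hw : dist w w₀ ≤ r / 2) : Deep W S (r / 2) C w where
  r_pos := half_pos h.r_pos
  subset := h.subset
  ball := (closedBall_subset_closedBall' (by linarith)).trans h.ball
  dist_le := h.dist_le

theorem eventually_dist_ext_le {φ : W.X → Euc n} (hφ : Good φ) (h : Deep W S r C w₀)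
    (hw₀ : w₀ ∈ W.carrier) {η : ℝ} (hη : 0 < η) :
    ∀ᶠ w in nhds w₀, dist (W.ext φ w) (W.ext φ w₀) ≤ (1 + η) * dist w w₀ := by
  by_contra hcon
  have hf : ∃ᶠ w in nhds w₀, ¬ dist (W.ext φ w) (W.ext φ w₀) ≤ (1 + η) * dist w w₀ :=
    not_eventually.1 hcon
  have he : ∀ᶠ w in nhds w₀, w ∈ W.carrier ∧ dist w w₀ ≤ r / 2 :=
    (show ∀ᶠ w in nhds w₀, w ∈ W.carrier from W.isOpen.mem_nhds hw₀).and
      (closedBall_mem_nhds w₀ (half_pos h.r_pos))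
  obtain ⟨w, hwl, hw⟩ := exists_seq_forall_of_frequently (hf.and_eventually he)
  have hd : ∀ j, Deep W S (r / 2) C (w j) := fun j => h.near (hw j).2.2
  choose m hm using fun j => (hd j).exists_max (hw j).2.1
  have hmb : ∀ j, dist (m j) (w j) ≤ C ^ 2 / (2 * (r / 2)) := fun j =>
    (hd j).dist_le_of_pow_nonneg ((pow_self (hd j) (hw j).2.1).le.trans (hm j _))
  have hbd : Bornology.IsBounded (range m) := by
    refine (isBounded_closedBall (x := w₀) (r := C ^ 2 / (2 * (r / 2)) + r / 2)).subset ?_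
    rintro _ ⟨j, rfl⟩
    exact (dist_triangle _ (w j) _).trans (add_le_add (hmb j) (hw j).2.2)
  obtain ⟨m₀, -, ψ, hψ, hlim⟩ := tendsto_subseq_of_bounded hbd fun j => mem_range_self j
  have hwl' := hwl.comp hψ.tendsto_atTop
  have hm₀ : ∀ m', W.pow w₀ m' ≤ W.pow w₀ m₀ := by
    intro m'
    have h1 := (continuous_pow (W := W)).tendsto (w₀, m') |>.comp
      (hwl'.prodMk_nhds (tendsto_const_nhds (x := m')))
    have h2 := (continuous_pow (W := W)).tendsto (w₀, m₀) |>.comp (hwl'.prodMk_nhds hlim)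
    exact le_of_tendsto_of_tendsto' h1 h2 fun j => hm _ _
  obtain ⟨c₀, hc₀m, hc₀R⟩ := h.exists_cell hw₀ hm₀
  choose c hcm hcR using fun j => (hd j).exists_cell (hw j).2.1 (hm j)
  have hmem : dist w₀ m₀ < c₀.R := hc₀m ▸ c₀.mem
  set δ := (c₀.R ^ 2 - dist w₀ m₀ ^ 2) / 2 with hδ
  have hδ0 : 0 < δ := half_pos (sub_pos.2 (pow_lt_pow_left₀ hmem dist_nonneg two_ne_zero))
  have hRl : Tendsto (fun j => (c (ψ j)).R) atTop (nhds c₀.R) := by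
    have := ((continuous_infDist_pt W.carrierᶜ).tendsto m₀).comp hlim
    rw [← hc₀R] at this
    exact this.congr fun j => (hcR _).symm
  have hml : Tendsto (fun j => dist w₀ (c (ψ j)).m) atTop (nhds (dist w₀ m₀)) := by
    simp_rw [hcm]
    exact tendsto_const_nhds.dist hlim
  have ev1 : ∀ᶠ j in atTop, dist w₀ (c (ψ j)).m ^ 2 - (c (ψ j)).R ^ 2 < -δ := by
    refine ((hml.pow 2).sub (hRl.pow 2)).eventually_lt_const ?_
    linarith
  have ev2 : ∀ᶠ j in atTop, (c (ψ j)).R + dist w₀ (c (ψ j)).m < 2 * c₀.R + 1 :=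
    (hRl.add hml).eventually_lt_const (by linarith)
  set L := 2 * c₀.R + 1 with hL
  have ev3 : ∀ᶠ j in atTop, L ^ 2 / δ ^ 2 * dist (c (ψ j)).m c₀.m ^ 2 < η := by
    have : Tendsto (fun j => dist (c (ψ j)).m c₀.m) atTop (nhds 0) := by
      simp_rw [hcm, hc₀m]
      simpa using hlim.dist (tendsto_const_nhds (x := m₀))
    refine ((this.pow 2).const_mul (L ^ 2 / δ ^ 2)).eventually_lt_const ?_
    simpa using hη
  obtain ⟨j, h1, h2, h3⟩ := (ev1.and (ev2.and ev3)).exists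
  refine (hw (ψ j)).1 ?_
  have key := (c (ψ j)).dist_val_sq_le c₀ hφ hδ0 h1.le (by rw [hc₀m]; linarith) (L := L)
    (fun i => ?_) (fun i => ?_)
  · rw [ext_eq hφ c₀, ext_eq hφ (c (ψ j))]
    refine abs_le_of_sq_le_sq' ?_ (by positivity) |>.2
    refine key.trans ?_
    rw [mul_pow]
    refine mul_le_mul_of_nonneg_right ?_ (sq_nonneg _)
    have := sq_nonneg η
    linarith [show (1 + η) ^ 2 = 1 + 2 * η + η ^ 2 by ring]
  · have := dist_triangle_right (W.π ((c (ψ j)).ξ i)) w₀ (c (ψ j)).m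
    rw [(c (ψ j)).dist_m] at this
    linarith
  · have := dist_triangle_right (W.π (c₀.ξ i)) w₀ c₀.m
    rw [c₀.dist_m, hc₀m] at this
    linarith

/-- The part of the domain where the extension is controlled by the complement points `S`. -/
def zone (W : Dom n) (S : Set (Euc n)) (C : ℝ) : Set (Euc n) :=
  {w | w ∈ W.carrier ∧ ∃ r, Deep W S r C w}

theorem continuousAt_ext {φ : W.X → Euc n} (hφ : Good φ) (h : w ∈ W.zone S C) :
    ContinuousAt (W.ext φ) w := by
  obtain ⟨hw, r, hd⟩ := h
  rw [ContinuousAt, tendsto_iff_dist_tendsto_zero]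
  refine squeeze_zero' (Eventually.of_forall fun _ => dist_nonneg)
    (eventually_dist_ext_le hφ hd hw one_pos) ?_
  have : Tendsto (fun v => (1 + 1) * dist v w) (nhds w) (nhds ((1 + 1) * dist w w)) :=
    ((continuous_id.dist continuous_const).tendsto w).const_mul _
  simpa using this

theorem dist_ext_le {φ : W.X → Euc n} (hφ : Good φ) {u v : Euc n}
    (h : segment ℝ u v ⊆ W.zone S C) : dist (W.ext φ u) (W.ext φ v) ≤ dist u v := by
  set γ : ℝ → Euc n := fun t => u + t • (v - u) with hγ
  have hγm : ∀ t ∈ Icc (0:ℝ) 1, γ t ∈ W.zone S C := fun t ht => h (by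
    rw [segment_eq_image']; exact ⟨t, ht, rfl⟩)
  have hγc : Continuous γ := by fun_prop
  have hγd : ∀ s t, dist (γ s) (γ t) = |s - t| * dist u v := by
    intro s t
    rw [hγ, dist_eq_norm, show u + s • (v - u) - (u + t • (v - u)) = (s - t) • (v - u) by module,
      norm_smul, Real.norm_eq_abs, dist_comm u, dist_eq_norm]
  have key : ∀ ⦃t⦄, t ∈ Icc (0:ℝ) 1 → dist (W.ext φ u) (W.ext φ (γ t)) ≤ t * dist u v := by
    refine image_le_of_liminf_slope_right_le_deriv_boundary (B' := fun _ => dist u v) ?_ ?_ ?_ ?_ ?_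
    · intro t ht
      exact tendsto_const_nhds.dist (((continuousAt_ext hφ (hγm t ht)).comp
        hγc.continuousAt).continuousWithinAt)
    · simp [hγ]
    · fun_prop
    · intro x _
      simpa using ((hasDerivAt_id x).mul_const (dist u v)).hasDerivWithinAt
    · intro x hx ρ hρ
      obtain ⟨hw, r, hd⟩ := hγm x (Ico_subset_Icc_self hx)
      obtain ⟨η, hη, hηρ⟩ : ∃ η : ℝ, 0 < η ∧ (1 + η) * dist u v < ρ := by
        refine ⟨(ρ - dist u v) / (dist u v + 1), by
          have := dist_nonneg (x := u) (y := v)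
          exact div_pos (by linarith) (by linarith), ?_⟩
        have h0 := dist_nonneg (x := u) (y := v)
        have h1 : dist u v / (dist u v + 1) < 1 := (div_lt_one (by linarith)).2 (by linarith)
        have h2 := mul_lt_mul_of_pos_left h1 (sub_pos.2 hρ)
        calc _ = dist u v + (ρ - dist u v) * (dist u v / (dist u v + 1)) := by ring
          _ < _ := by linarith
      have ev := (hγc.tendsto x).eventually (eventually_dist_ext_le hφ hd hw hη)
      have ev' : ∀ᶠ z in nhdsWithin x (Ioi x),
          slope (fun t => dist (W.ext φ u) (W.ext φ (γ t))) x z < ρ := by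
        filter_upwards [ev.filter_mono nhdsWithin_le_nhds, self_mem_nhdsWithin] with z hz hxz
        have hxz' : 0 < z - x := sub_pos.2 hxz
        rw [slope_def_field, div_lt_iff₀ hxz']
        rw [hγd, abs_of_pos hxz'] at hz
        have h1 := dist_triangle_right (W.ext φ u) (W.ext φ (γ z)) (W.ext φ (γ x))
        have h2 := mul_lt_mul_of_pos_right hηρ hxz'
        have h3 := dist_triangle (W.ext φ u) (W.ext φ (γ x)) (W.ext φ (γ z))
        rw [dist_comm (W.ext φ (γ x))] at h3
        linarith
      exact ev'.frequently
  have := key (right_mem_Icc.2 zero_le_one)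
  simpa [hγ] using this

theorem dist_ext_sq_le {φ : W.X → Euc n} (hφ : Good φ) (h : w ∈ W.zone S C) {ξ : W.X}
    (hξ : Bd ξ) :
    dist (W.ext φ w) (φ ξ) ^ 2 ≤ dist (W.ι w) ξ ^ 2 + 2 * C * dist (W.ι w) ξ := by
  obtain ⟨hw, r, hd⟩ := h
  obtain ⟨m, hm⟩ := hd.exists_max hw
  obtain ⟨c, hcm, hcR⟩ := hd.exists_cell hw hm
  set κ := dist (W.ι w) ξ with hκ
  have hκ0 : 0 ≤ κ := dist_nonneg
  rw [ext_eq hφ c]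
  have hvar : ∑ i, c.lam i * dist (W.π (c.ξ i)) w ^ 2 ≤ C ^ 2 := by
    have h1 := hd.pow_le m
    have h2 : 0 ≤ 2 * r * dist m w := by have := hd.r_pos; positivity
    rw [c.variance, hcR, hcm]
    rw [pow, dist_comm m w] at h1
    rw [dist_comm m w] at h2
    linarith
  have hC : 0 ≤ C := by
    obtain ⟨s, hs⟩ := convexHull_nonempty_iff.1 ⟨w, hd.mem_hull⟩
    exact dist_nonneg.trans (hd.dist_le s hs w hd.mem_hull)
  have hmean : ∑ i, c.lam i * dist (W.π (c.ξ i)) w ≤ C := by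
    refine abs_le_of_sq_le_sq' (le_trans ?_ hvar) hC |>.2
    have hj := (even_two.convexOn_pow (𝕜 := ℝ)).map_sum_le (t := Finset.univ) (w := c.lam)
      (p := fun i => dist (W.π (c.ξ i)) w) (fun i _ => (c.lam_pos i).le) c.sum_lam
      fun i _ => mem_univ _
    simpa only [smul_eq_mul] using hj
  have hle : ∀ i, dist (φ (c.ξ i)) (φ ξ) ^ 2 ≤
      dist (W.π (c.ξ i)) w ^ 2 + 2 * κ * dist (W.π (c.ξ i)) w + κ ^ 2 := by
    intro i
    have h1 := hφ.lip _ _ (c.bd i) hξ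
    have h2 := dist_triangle_left (c.ξ i) ξ (W.ι w)
    have h3 := (c.sees i).2 w c.mem
    rw [dist_comm w] at h3
    have h4 : dist (φ (c.ξ i)) (φ ξ) ≤ dist (W.π (c.ξ i)) w + κ := by linarith
    refine (pow_le_pow_left₀ dist_nonneg h4 2).trans_eq (by ring)
  have h1 := sum_dist_sq c.sum_lam (fun i => φ (c.ξ i)) (φ ξ)
  have h2 := c.variance_φ hφ
  rw [← c.variance] at h2
  have h3 : ∑ i, c.lam i * dist (φ (c.ξ i)) (φ ξ) ^ 2 ≤
      ∑ i, c.lam i * dist (W.π (c.ξ i)) w ^ 2 +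
        2 * κ * ∑ i, c.lam i * dist (W.π (c.ξ i)) w + κ ^ 2 := by
    calc _ ≤ ∑ i, (c.lam i * dist (W.π (c.ξ i)) w ^ 2 +
          2 * κ * (c.lam i * dist (W.π (c.ξ i)) w) + c.lam i * κ ^ 2) := by
          refine Finset.sum_le_sum fun i _ => ?_
          exact (mul_le_mul_of_nonneg_left (hle i) (c.lam_pos i).le).trans_eq (by ring)
      _ = _ := by
          rw [Finset.sum_add_distrib, Finset.sum_add_distrib, ← Finset.mul_sum, ← Finset.sum_mul,
            c.sum_lam, one_mul]
  have h4 := mul_le_mul_of_nonneg_left hmean (show 0 ≤ 2 * κ by positivity)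
  unfold Cell.val at h2 ⊢
  linarith

/-- If `[w, π ξ[` lies in the zone and sees `ξ`, the extension moves `w` no farther from `φ ξ`. -/
theorem dist_ext_le_of_sees {φ : W.X → Euc n} (hφ : Good φ) {ξ : W.X} (hξ : Bd ξ)
    {A : Set (Euc n)} (hA : Sees A ξ) (hw : w ∈ W.zone S C)
    (h : openSegment ℝ w (W.π ξ) ⊆ W.zone S C ∩ A) :
    dist (W.ext φ w) (φ ξ) ≤ dist w (W.π ξ) := by
  set e := W.π ξ with he
  have h1 : e ∈ closure (openSegment ℝ w e) := by
    rw [closure_openSegment]; exact right_mem_segment _ _ _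
  obtain ⟨s, hs, hlim⟩ := mem_closure_iff_seq_limit.1 h1
  have h2 : ∀ k, dist (W.ext φ w) (W.ext φ (s k)) ≤ dist w (s k) := fun k => by
    refine dist_ext_le (S := S) (C := C) hφ ?_
    refine (segment_subset_insert_openSegment w e (hs k)).trans ?_
    exact insert_subset hw (h.trans inter_subset_left)
  have h3 : Tendsto (fun k => dist (W.ι (s k)) ξ) atTop (nhds 0) := by
    refine squeeze_zero (fun _ => dist_nonneg) (fun k => hA.2 _ (h (hs k)).2) ?_
    simpa using hlim.dist (tendsto_const_nhds (x := e))
  have h4 : Tendsto (fun k => W.ext φ (s k)) atTop (nhds (φ ξ)) := by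
    rw [tendsto_iff_dist_tendsto_zero]
    have h5 : Tendsto (fun k => dist (W.ext φ (s k)) (φ ξ) ^ 2) atTop (nhds 0) := by
      refine squeeze_zero (fun _ => sq_nonneg _)
        (fun k => dist_ext_sq_le hφ (h (hs k)).1 hξ) ?_
      simpa using (h3.pow 2).add (h3.const_mul (2 * C))
    have := h5.sqrt
    simpa using this
  exact le_of_tendsto_of_tendsto' (tendsto_const_nhds.dist h4) (tendsto_const_nhds.dist hlim) h2

end Dom

namespace Dom
variable {n : ℕ}

theorem dist_sum_smul_congr {I : Type*} [Fintype I] {lam mu : I → ℝ} (hl : ∑ i, lam i = 1)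
    (hm : ∑ i, mu i = 1) {p q : I → Euc n} (h : ∀ i j, dist (p i) (p j) = dist (q i) (q j)) :
    dist (∑ i, lam i • p i) (∑ i, mu i • p i) = dist (∑ i, lam i • q i) (∑ i, mu i • q i) := by
  have h1 := sum_sum_dist_sq hl hm p p
  have h2 := sum_sum_dist_sq hl hm q q
  simp_rw [h] at h1
  have h3 := variance_congr hl h
  have h4 := variance_congr hm h
  refine (pow_left_inj₀ dist_nonneg dist_nonneg two_ne_zero).1 ?_
  linarith

/-- A point no farther from the vertices of a congruent copy than `∑ lam i • p i` is from the
original ones is the corresponding point. -/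
theorem eq_sum_smul_of_dist_le {I : Type*} [Fintype I] {lam : I → ℝ} (h0 : ∀ i, 0 ≤ lam i)
    (hl : ∑ i, lam i = 1) {p q : I → Euc n} (h : ∀ i j, dist (p i) (p j) = dist (q i) (q j))
    {x : Euc n} (hx : ∀ i, dist x (q i) ≤ dist (∑ i, lam i • p i) (p i)) :
    x = ∑ i, lam i • q i := by
  have h1 := sum_dist_sq hl q x
  rw [← variance_congr hl h] at h1
  have h2 : ∑ i, lam i * dist (q i) x ^ 2 ≤ ∑ i, lam i * dist (p i) (∑ i, lam i • p i) ^ 2 := by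
    refine Finset.sum_le_sum fun i _ => mul_le_mul_of_nonneg_left ?_ (h0 i)
    rw [dist_comm, dist_comm (p i)]
    exact pow_le_pow_left₀ dist_nonneg (hx i) 2
  have h3 : dist (∑ i, lam i • q i) x ^ 2 ≤ 0 := by linarith
  exact (dist_eq_zero.1 (pow_eq_zero_iff two_ne_zero |>.1 (h3.antisymm (sq_nonneg _)))).symm

/-- The affine basis formed by three affinely independent points of the plane. -/
def triBasis {b : Fin 3 → Euc 2} (hb : AffineIndependent ℝ b) : AffineBasis (Fin 3) ℝ (Euc 2) :=
  ⟨b, hb, hb.affineSpan_eq_top_iff_card_eq_finrank_add_one.2 (by simp)⟩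

@[simp] theorem coe_triBasis {b : Fin 3 → Euc 2} (hb : AffineIndependent ℝ b) :
    ⇑(triBasis hb) = b := rfl

section
variable {b : Fin 3 → Euc 2} (hb : AffineIndependent ℝ b)

theorem sum_coord_smul (x : Euc 2) : ∑ i, (triBasis hb).coord i x • b i = x :=
  (triBasis hb).linear_combination_coord_eq_self x

theorem sum_coord (x : Euc 2) : ∑ i, (triBasis hb).coord i x = 1 :=
  (triBasis hb).sum_coord_apply_eq_one x

theorem coord_sum_smul {lam : Fin 3 → ℝ} (hl : ∑ i, lam i = 1) (i : Fin 3) :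
    (triBasis hb).coord i (∑ j, lam j • b j) = lam i := by
  rw [← (triBasis hb).coord_apply_combination_of_mem (Finset.mem_univ i) hl,
    Finset.affineCombination_eq_linear_combination _ _ _ hl, coe_triBasis]

theorem mem_hull_iff (x : Euc 2) :
    x ∈ convexHull ℝ (range b) ↔ ∀ i, 0 ≤ (triBasis hb).coord i x := by
  have := (triBasis hb).convexHull_eq_nonneg_coord
  rw [coe_triBasis] at this
  rw [this]; rfl

theorem mem_interior_hull_iff (x : Euc 2) :
    x ∈ interior (convexHull ℝ (range b)) ↔ ∀ i, 0 < (triBasis hb).coord i x := by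
  have := (triBasis hb).interior_convexHull
  rw [coe_triBasis] at this
  rw [this]; rfl

end

theorem exists_affineIsometry {a b : Fin 3 → Euc 2} (ha : AffineIndependent ℝ a)
    (h : ∀ i j, dist (a i) (a j) = dist (b i) (b j)) :
    ∃ J : Euc 2 →ᵃⁱ[ℝ] Euc 2, ∀ i, J (a i) = b i := by
  let g : Euc 2 → Euc 2 := fun x => ∑ i, (triBasis ha).coord i x • b i
  have hg : Isometry g := Isometry.of_dist_eq fun x y => by
    have := dist_sum_smul_congr (sum_coord ha x) (sum_coord ha y) h
    rw [sum_coord_smul, sum_coord_smul] at this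
    exact this.symm
  refine ⟨hg.affineIsometryOfStrictConvexSpace, fun i => ?_⟩
  change ∑ j, (triBasis ha).coord j (a i) • b j = b i
  have h1 : ∀ j, (triBasis ha).coord j (a i) = if j = i then 1 else 0 := fun j =>
    (triBasis ha).coord_apply j i
  simp [h1]

theorem affineIndependent_of_dist_eq {a b : Fin 3 → Euc 2} (ha : AffineIndependent ℝ a)
    (h : ∀ i j, dist (a i) (a j) = dist (b i) (b j)) : AffineIndependent ℝ b := by
  obtain ⟨J, hJ⟩ := exists_affineIsometry ha h
  have h1 := ha.map' J.toAffineMap J.injective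
  have h2 : ⇑J.toAffineMap ∘ a = b := funext hJ
  rwa [h2] at h1

theorem mem_zone {W : Dom 2} {b : Fin 3 → Euc 2} (hbW : ∀ i, b i ∉ W.carrier) {w : Euc 2}
    (hw : w ∈ W.carrier) (hw' : w ∈ interior (convexHull ℝ (range b))) :
    w ∈ W.zone (range b) (diam (convexHull ℝ (range b))) := by
  obtain ⟨r, hr, h⟩ := Metric.isOpen_iff.1 isOpen_interior w hw'
  refine ⟨hw, r / 2, half_pos hr, ?_, ?_, fun s hs p hp => ?_⟩
  · rintro _ ⟨i, rfl⟩; exact hbW i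
  · exact (closedBall_subset_ball (half_lt_self hr)).trans (h.trans interior_subset)
  · exact dist_le_diam_of_mem (isBounded_convexHull.2 (finite_range b).isBounded)
      (subset_convexHull ℝ _ hs) hp

theorem exists_first_exit {W : Dom n} {p c : Euc n} (hp : p ∈ W.carrier) (hc : c ∉ W.carrier) :
    ∃ e ∈ segment ℝ p c, e ≠ p ∧ e ∉ W.carrier ∧ openSegment ℝ p e ⊆ W.carrier := by
  set γ : ℝ → Euc n := fun t => p + t • (c - p) with hγ
  have hγc : Continuous γ := by fun_prop
  have hK : IsCompact (Icc (0:ℝ) 1 ∩ γ ⁻¹' W.carrierᶜ) :=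
    isCompact_Icc.inter_right (W.isClosed_compl.preimage hγc)
  obtain ⟨t, ⟨ht, htW⟩, hmin⟩ := hK.exists_isLeast ⟨1, right_mem_Icc.2 zero_le_one, by
    simpa [hγ] using hc⟩
  have ht0 : t ≠ 0 := by
    rintro rfl
    exact htW (by simpa [hγ] using hp)
  refine ⟨γ t, by rw [segment_eq_image']; exact ⟨t, ht, rfl⟩, ?_, htW, ?_⟩
  · intro h; exact htW (show γ t ∈ W.carrier by rwa [h])
  · rw [openSegment_eq_image']
    rintro _ ⟨s, hs, rfl⟩
    by_contra hcon
    have hst : s * t < t := mul_lt_of_lt_one_left (ht.1.lt_of_ne ht0.symm) hs.2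
    have e1 : p + s • (γ t - p) = γ (s * t) := by rw [hγ]; module
    beta_reduce at hcon
    rw [e1] at hcon
    exact absurd (hmin ⟨⟨mul_nonneg hs.1.le ht.1, hst.le.trans ht.2⟩, hcon⟩) (not_le.2 hst)

end Dom

namespace Dom

/-- Three boundary elements joined pairwise by boundary intervals and fixed by `φ`. -/
structure Tri {W : Dom 2} (φ : W.X → Euc 2) (η : Fin 3 → W.X) : Prop where
  good : Good φ
  edge : ∀ i j, i ≠ j → Edge (η i) (η j)
  indep : AffineIndependent ℝ fun i => W.π (η i)
  fixed : ∀ i, φ (η i) = W.π (η i)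

/-- The triangle spanned by the supports. -/
def hull {W : Dom 2} (η : Fin 3 → W.X) : Set (Euc 2) := convexHull ℝ (range fun i => W.π (η i))

variable {W : Dom 2} {φ : W.X → Euc 2} {η : Fin 3 → W.X}

theorem π_mem_hull (η : Fin 3 → W.X) (i : Fin 3) : W.π (η i) ∈ hull η :=
  subset_convexHull ℝ _ (mem_range_self i)

theorem openSegment_subset_interior_hull {w p : Euc 2} (hw : w ∈ interior (hull η))
    (hp : p ∈ hull η) : openSegment ℝ w p ⊆ interior (hull η) :=
  (convex_convexHull ℝ _).openSegment_interior_closure_subset_interior hw (subset_closure hp)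

namespace Tri

theorem bd (h : Tri φ η) (i : Fin 3) : Bd (η i) := by
  obtain ⟨j, hj⟩ := exists_ne i
  exact (h.edge i j hj.symm).bd_left

theorem mem_zone (h : Tri φ η) {w : Euc 2} (hw : w ∈ W.carrier) (hw' : w ∈ interior (hull η)) :
    w ∈ W.zone (range fun i => W.π (η i)) (diam (hull η)) :=
  Dom.mem_zone (fun i => (h.bd i).π_notMem) hw hw'

theorem mem_hull_of_side {i j : Fin 3} {p : Euc 2}
    (hp : p ∈ openSegment ℝ (W.π (η i)) (W.π (η j))) : p ∈ hull η :=
  (convex_convexHull ℝ _).openSegment_subset (π_mem_hull η i) (π_mem_hull η j) hp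

theorem eventually_dist_ext_vertex_le (h : Tri φ η) {i j : Fin 3} (hij : i ≠ j) {p : Euc 2}
    (hp : p ∈ openSegment ℝ (W.π (η i)) (W.π (η j))) {e : ℝ} (he : 0 < e) :
    ∀ᶠ z in nhds p, z ∈ interior (hull η) →
      dist (W.ext φ z) (W.π (η i)) ≤ dist p (W.π (η i)) + e := by
  set x := W.π (η i) with hx
  set C := diam (hull η) with hC
  have hC0 : 0 ≤ C := diam_nonneg
  have hE := h.edge i j hij
  obtain ⟨κ, hκ0, hκ⟩ : ∃ κ : ℝ, 0 < κ ∧ κ ^ 2 + 2 * C * κ ≤ (e / 2) ^ 2 := by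
    refine ⟨min 1 ((e / 2) ^ 2 / (1 + 2 * C)), by positivity, ?_⟩
    set κ := min 1 ((e / 2) ^ 2 / (1 + 2 * C))
    have h0 : 0 ≤ κ := by positivity
    have h1 : κ ≤ 1 := min_le_left _ _
    have h2 : κ * (1 + 2 * C) ≤ (e / 2) ^ 2 := (le_div_iff₀ (by positivity)).1 (min_le_right _ _)
    have h3 := mul_le_mul_of_nonneg_left h1 h0
    linarith [show κ ^ 2 = κ * κ by ring, show κ * (1 + 2 * C) = κ + 2 * C * κ by ring]
  set ℓ := dist p x with hℓ
  have hℓ0 : 0 ≤ ℓ := dist_nonneg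
  obtain ⟨ε, hε0, hε1, hε⟩ : ∃ ε : ℝ, 0 < ε ∧ ε < 1 ∧ ε * (ℓ + 1) ≤ κ :=
    ⟨min (1 / 2) (κ / (ℓ + 1)), by positivity, (min_le_left _ _).trans_lt (by norm_num),
      (le_div_iff₀ (by positivity)).1 (min_le_right _ _)⟩
  set sh : Euc 2 → Euc 2 := fun z => x + ε • (z - x) with hsh
  have hshp : sh p ∈ openSegment ℝ x p := by
    rw [openSegment_eq_image']; exact ⟨ε, ⟨hε0, hε1⟩, rfl⟩
  have hshs : sh p ∈ openSegment ℝ x (W.π (η j)) := by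
    rw [openSegment_eq_image'] at hp ⊢
    obtain ⟨t, ht, rfl⟩ := hp
    exact ⟨ε * t, ⟨mul_pos hε0 ht.1, (mul_le_of_le_one_left ht.1.le hε1.le).trans_lt ht.2⟩, by
      rw [hsh]; module⟩
  have hKW : segment ℝ p (sh p) ⊆ W.carrier :=
    ((convex_openSegment x (W.π (η j))).segment_subset hp hshs).trans hE.sees_left.1
  have hKc : IsCompact (segment ℝ p (sh p)) := by
    rw [segment_eq_image']
    exact isCompact_Icc.image (by fun_prop)
  obtain ⟨δ, hδ, hδW⟩ := hKc.exists_thickening_subset_open W.isOpen hKW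
  have hshd : ∀ z, dist (sh z) (sh p) = ε * dist z p := fun z => by
    rw [hsh, dist_eq_norm, show x + ε • (z - x) - (x + ε • (p - x)) = ε • (z - p) by module,
      norm_smul, Real.norm_eq_abs, abs_of_pos hε0, dist_eq_norm]
  have hmin : 0 < min (min δ 1) (e / 2) := by positivity
  filter_upwards [ball_mem_nhds p hmin] with z hz hzi
  have hz1 : dist z p < δ := hz.trans_le ((min_le_left _ _).trans (min_le_left _ _))
  have hz2 : dist z p < 1 := hz.trans_le ((min_le_left _ _).trans (min_le_right _ _))
  have hz3 : dist z p < e / 2 := hz.trans_le (min_le_right _ _)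
  have hshz : sh z ∈ interior (hull η) := by
    refine openSegment_subset_interior_hull hzi (π_mem_hull η i) ?_
    rw [openSegment_symm, openSegment_eq_image']
    exact ⟨ε, ⟨hε0, hε1⟩, rfl⟩
  have hsegI : segment ℝ z (sh z) ⊆ interior (hull η) :=
    (convex_convexHull ℝ _).interior.segment_subset hzi hshz
  have hsegW : segment ℝ z (sh z) ⊆ W.carrier := by
    refine Subset.trans ?_ hδW
    rw [segment_eq_image']
    rintro _ ⟨s, hs, rfl⟩
    refine mem_thickening_iff.2 ⟨p + s • (sh p - p), by
      rw [segment_eq_image']; exact ⟨s, hs, rfl⟩, ?_⟩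
    rw [dist_eq_norm, show z + s • (sh z - z) - (p + s • (sh p - p)) =
      (1 - s * (1 - ε)) • (z - p) by rw [hsh]; module, norm_smul, Real.norm_eq_abs, ← dist_eq_norm]
    refine (mul_le_of_le_one_left dist_nonneg ?_).trans_lt hz1
    have h1 : 0 ≤ s * (1 - ε) := mul_nonneg hs.1 (by linarith)
    have h2 : s * (1 - ε) ≤ 1 := mul_le_one₀ hs.2 (by linarith) (by linarith)
    rw [abs_of_nonneg (by linarith)]
    linarith
  have h1 := dist_ext_le h.good fun v hv => h.mem_zone (hsegW hv) (hsegI hv)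
  have h2 : dist z (sh z) ≤ dist z x := by
    rw [hsh, dist_eq_norm, show z - (x + ε • (z - x)) = (1 - ε) • (z - x) by module, norm_smul,
      Real.norm_eq_abs, abs_of_pos (by linarith), ← dist_eq_norm]
    exact mul_le_of_le_one_left dist_nonneg (by linarith)
  have h3 : dist (W.ι (sh z)) (η i) ≤ κ := by
    have hb : ball (sh p) δ ⊆ W.carrier := fun v hv =>
      hδW (mem_thickening_iff.2 ⟨sh p, right_mem_segment _ _ _, hv⟩)
    have hzb : sh z ∈ ball (sh p) δ := by
      rw [mem_ball, hshd]
      exact (mul_le_of_le_one_left dist_nonneg hε1.le).trans_lt hz1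
    have e1 : dist (W.ι (sh z)) (W.ι (sh p)) = ε * dist z p := by
      rw [← hshd, dist_ι_of_segment]
      rw [segment_symm]
      exact ball_segment_subset hb hzb
    have e2 := hE.sees_left.2 _ hshs
    have e3 : dist (sh p) x = ε * ℓ := by
      rw [hsh, dist_eq_norm, add_sub_cancel_left, norm_smul, Real.norm_eq_abs, abs_of_pos hε0,
        ← dist_eq_norm]
    rw [← hx, e3] at e2
    have e4 := mul_le_mul_of_nonneg_left hz2.le hε0.le
    linarith [dist_triangle (W.ι (sh z)) (W.ι (sh p)) (η i)]
  have h4 := dist_ext_sq_le h.good (h.mem_zone (hsegW (right_mem_segment _ _ _)) hshz) (h.bd i)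
  rw [h.fixed, ← hx, ← hC] at h4
  have h5 : dist (W.ext φ (sh z)) x ≤ e / 2 := by
    refine abs_le_of_sq_le_sq' ?_ (by positivity) |>.2
    refine h4.trans (le_trans ?_ hκ)
    have := mul_le_mul_of_nonneg_left h3 (show 0 ≤ 2 * C by positivity)
    linarith [pow_le_pow_left₀ dist_nonneg h3 2]
  linarith [dist_triangle (W.ext φ z) (W.ext φ (sh z)) x, dist_triangle z p x]

theorem tendsto_ext_side (h : Tri φ η) {i j : Fin 3} (hij : i ≠ j) {p : Euc 2}
    (hp : p ∈ openSegment ℝ (W.π (η i)) (W.π (η j))) :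
    Tendsto (W.ext φ) (nhdsWithin p (interior (hull η))) (nhds p) := by
  rw [Metric.tendsto_nhds]
  intro ε hε
  set x := W.π (η i)
  set y := W.π (η j)
  set M := 2 * (dist p x + dist p y) + 1 with hM
  have hM0 : 0 < M := by positivity
  obtain ⟨e, he0, he1, heM⟩ : ∃ e : ℝ, 0 < e ∧ e ≤ 1 ∧ e * M < ε ^ 2 := by
    refine ⟨min 1 (ε ^ 2 / (2 * M)), by positivity, min_le_left _ _, ?_⟩
    calc _ ≤ ε ^ 2 / (2 * M) * M := mul_le_mul_of_nonneg_right (min_le_right _ _) hM0.le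
      _ = ε ^ 2 / 2 := by field_simp
      _ < _ := by have : 0 < ε ^ 2 := by positivity
                  linarith
  have h1 := h.eventually_dist_ext_vertex_le hij hp he0
  have h2 := h.eventually_dist_ext_vertex_le hij.symm (openSegment_symm ℝ x y ▸ hp) he0
  filter_upwards [h1.filter_mono nhdsWithin_le_nhds, h2.filter_mono nhdsWithin_le_nhds,
    self_mem_nhdsWithin] with z hz1 hz2 hz
  specialize hz1 hz
  specialize hz2 hz
  have key : ∀ v, dist (W.ext φ z) v ≤ dist p v + e → dist p v ≤ dist p x + dist p y →
      dist v (W.ext φ z) ^ 2 ≤ dist v p ^ 2 + e * M := by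
    intro v hv hv'
    rw [dist_comm v, dist_comm v]
    refine (pow_le_pow_left₀ dist_nonneg hv 2).trans ?_
    have e1 := mul_le_mul_of_nonneg_left hv' he0.le
    have e2 := mul_le_mul_of_nonneg_left he1 he0.le
    linarith [show (dist p v + e) ^ 2 = dist p v ^ 2 + 2 * (e * dist p v) + e * e by ring,
      show e * M = 2 * (e * (dist p x + dist p y)) + e by rw [hM]; ring]
  have kx := key x hz1 (by linarith [dist_nonneg (x := p) (y := y)])
  have ky := key y hz2 (by linarith [dist_nonneg (x := p) (y := x)])
  rw [openSegment_eq_image] at hp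
  obtain ⟨t, ht, rfl⟩ := hp
  beta_reduce at kx ky ⊢
  have a1 := dist_sq_affine x y (W.ext φ z) t
  have a2 := dist_sq_affine x y ((1 - t) • x + t • y) t
  rw [dist_self, zero_pow two_ne_zero] at a2
  have k1 := mul_le_mul_of_nonneg_left kx (sub_nonneg.2 ht.2.le)
  have k2 := mul_le_mul_of_nonneg_left ky ht.1.le
  refine abs_lt_of_sq_lt_sq' ?_ hε.le |>.2
  rw [dist_comm]
  linarith

/-- The extension moves `w` no farther from a side point that is visible from `w`. -/
theorem dist_ext_side_le (h : Tri φ η) {i j : Fin 3} (hij : i ≠ j) {p w : Euc 2}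
    (hp : p ∈ openSegment ℝ (W.π (η i)) (W.π (η j))) (hw : w ∈ interior (hull η))
    (hwW : w ∈ W.carrier) (hs : openSegment ℝ w p ⊆ W.carrier) :
    dist (W.ext φ w) p ≤ dist w p := by
  have hI : openSegment ℝ w p ⊆ interior (hull η) :=
    openSegment_subset_interior_hull hw (mem_hull_of_side hp)
  have h1 : p ∈ closure (openSegment ℝ w p) := by
    rw [closure_openSegment]; exact right_mem_segment _ _ _
  obtain ⟨s, hsm, hlim⟩ := mem_closure_iff_seq_limit.1 h1
  have h2 : ∀ k, dist (W.ext φ w) (W.ext φ (s k)) ≤ dist w (s k) := fun k => by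
    refine dist_ext_le (S := range fun i => W.π (η i)) (C := diam (hull η)) h.good ?_
    refine (segment_subset_insert_openSegment w p (hsm k)).trans ?_
    exact insert_subset (h.mem_zone hwW hw) fun v hv => h.mem_zone (hs hv) (hI hv)
  have h3 : Tendsto (fun k => W.ext φ (s k)) atTop (nhds p) :=
    (h.tendsto_ext_side hij hp).comp
      (tendsto_nhdsWithin_iff.2 ⟨hlim, Eventually.of_forall fun k => hI (hsm k)⟩)
  exact le_of_tendsto_of_tendsto' (tendsto_const_nhds.dist h3) (tendsto_const_nhds.dist hlim) h2

end Tri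

end Dom

namespace Dom

theorem univ_fin_three {i j k : Fin 3} (hij : i ≠ j) (hik : i ≠ k) (hjk : j ≠ k) :
    (Finset.univ : Finset (Fin 3)) = {i, j, k} := by
  revert i j k; decide

theorem sum_fin_three {M : Type*} [AddCommMonoid M] {i j k : Fin 3} (hij : i ≠ j) (hik : i ≠ k)
    (hjk : j ≠ k) (f : Fin 3 → M) : ∑ l, f l = f i + (f j + f k) := by
  rw [univ_fin_three hij hik hjk, Finset.sum_insert (by simp [hij, hik]), Finset.sum_pair hjk]

theorem exists_other_two (k : Fin 3) : ∃ i j : Fin 3, i ≠ j ∧ i ≠ k ∧ j ≠ k := by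
  revert k; decide

section
variable {b : Fin 3 → Euc 2} (hb : AffineIndependent ℝ b) {m : Euc 2} {R : ℝ}

theorem mem_openSegment_of_coord {i j k : Fin 3} (hij : i ≠ j) (hik : i ≠ k) (hjk : j ≠ k)
    {p : Euc 2} (hk : (triBasis hb).coord k p = 0) (hi : 0 < (triBasis hb).coord i p)
    (hj : 0 < (triBasis hb).coord j p) : p ∈ openSegment ℝ (b i) (b j) := by
  have h1 := sum_coord hb p
  have h2 := sum_coord_smul hb p
  rw [sum_fin_three hij hik hjk, hk] at h1
  rw [sum_fin_three hij hik hjk, hk] at h2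
  exact ⟨_, _, hi, hj, by linarith, by simpa using h2⟩

theorem mem_openSegment_of_dist_lt (hR : ∀ l, dist (b l) m = R) {i j k : Fin 3} (hij : i ≠ j)
    (hik : i ≠ k) (hjk : j ≠ k) {p : Euc 2} (hk : (triBasis hb).coord k p = 0)
    (hp : dist p m < R) : p ∈ openSegment ℝ (b i) (b j) := by
  have h1 := sum_coord hb p
  have h2 := sum_coord_smul hb p
  rw [sum_fin_three hij hik hjk, hk] at h1
  rw [sum_fin_three hij hik hjk, hk] at h2
  set t := (triBasis hb).coord j p
  have ht : (triBasis hb).coord i p = 1 - t := by linarith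
  rw [ht, zero_smul, add_zero] at h2
  have h3 := dist_sq_affine (b i) (b j) m t
  rw [h2, hR, hR] at h3
  have h4 := pow_lt_pow_left₀ hp dist_nonneg two_ne_zero
  have h5 : 0 < t * (1 - t) * dist (b i) (b j) ^ 2 := by linarith
  have h6 : 0 < t * (1 - t) := pos_of_mul_pos_left h5 (sq_nonneg _)
  have h7 : 0 < t := by
    by_contra! h
    linarith [mul_nonneg (neg_nonneg.2 h) (show 0 ≤ 1 - t by linarith)]
  exact ⟨1 - t, t, pos_of_mul_pos_right h6 h7.le, h7, by ring, h2⟩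

theorem dist_eq_dist_reflection (hR : ∀ l, dist (b l) m = R) {i j k : Fin 3} (hij : i ≠ j)
    (hik : i ≠ k) (hjk : j ≠ k) {p : Euc 2} (hk : (triBasis hb).coord k p = 0) :
    dist p (b i + b j - m) = dist p m := by
  have h1 := sum_coord hb p
  have h2 := sum_coord_smul hb p
  rw [sum_fin_three hij hik hjk, hk] at h1
  rw [sum_fin_three hij hik hjk, hk] at h2
  set t := (triBasis hb).coord j p
  have ht : (triBasis hb).coord i p = 1 - t := by linarith
  rw [ht, zero_smul, add_zero] at h2
  have h3 := dist_sq_affine (b i) (b j) m t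
  have h4 := dist_sq_affine (b i) (b j) (b i + b j - m) t
  have e1 : dist (b i) (b i + b j - m) = R := by
    rw [← hR j, dist_comm, dist_eq_norm, dist_eq_norm]; congr 1; abel
  have e2 : dist (b j) (b i + b j - m) = R := by
    rw [← hR i, dist_comm, dist_eq_norm, dist_eq_norm]; congr 1; abel
  rw [h2, hR, hR] at h3
  rw [h2, e1, e2, ← h3] at h4
  exact (pow_left_inj₀ dist_nonneg dist_nonneg two_ne_zero).1 h4

theorem coord_add_smul_sub (x y : Euc 2) (s : ℝ) (k : Fin 3) :
    (triBasis hb).coord k (x + s • (y - x)) =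
      (1 - s) * (triBasis hb).coord k x + s * (triBasis hb).coord k y := by
  rw [show x + s • (y - x) = AffineMap.lineMap x y s by
    rw [AffineMap.lineMap_apply, vsub_eq_sub, vadd_eq_add, add_comm], AffineMap.apply_lineMap,
    AffineMap.lineMap_apply_ring]

/-- A point on `[c, e]` with vanishing `k`-th coordinate. -/
theorem exists_coord_eq_zero {c e : Euc 2} {k : Fin 3} (hc : 0 < (triBasis hb).coord k c)
    (he : (triBasis hb).coord k e ≤ 0) :
    ∃ p, (triBasis hb).coord k p = 0 ∧ dist p c + dist p e = dist c e ∧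
      dist p e ≤ dist c e := by
  set γ := (triBasis hb).coord k c
  set δ := (triBasis hb).coord k e
  set s := γ / (γ - δ) with hs
  have hd : 0 < γ - δ := by linarith
  have hs0 : 0 < s := by positivity
  have hs1 : s ≤ 1 := (div_le_one hd).2 (by linarith)
  have h1 : dist (c + s • (e - c)) c = s * dist c e := by
    rw [dist_eq_norm, add_sub_cancel_left, norm_smul, Real.norm_eq_abs, abs_of_pos hs0,
      ← dist_eq_norm, dist_comm]
  have h2 : dist (c + s • (e - c)) e = (1 - s) * dist c e := by
    rw [dist_eq_norm, show c + s • (e - c) - e = (1 - s) • (c - e) by module, norm_smul,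
      Real.norm_eq_abs, abs_of_nonneg (by linarith), ← dist_eq_norm]
  have h3 : 0 ≤ s * dist c e := by positivity
  refine ⟨c + s • (e - c), ?_, by linarith, by linarith⟩
  rw [coord_add_smul_sub]
  change (1 - s) * γ + s * δ = 0
  rw [hs]; field_simp; ring

/-- The orthocenter is the only interior point `c` for which every side point `p` satisfies
`R ≤ dist p c + dist p m`, `m` and `R` being circumcenter and circumradius. -/
theorem eq_orthocenter (hb : AffineIndependent ℝ b) (hR0 : 0 < R)
    (hR : ∀ l, dist (b l) m = R) {c : Euc 2}
    (hc : c ∈ interior (convexHull ℝ (range b)))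
    (h : ∀ i j, i ≠ j → ∀ p ∈ openSegment ℝ (b i) (b j), R ≤ dist p c + dist p m) :
    c = ∑ l, b l - (2 : ℝ) • m := by
  have hl := (mem_interior_hull_iff hb c).1 hc
  have hcm : dist c m < R := by
    have h1 : convexHull ℝ (range b) ⊆ closedBall m R :=
      convexHull_min (by rintro _ ⟨i, rfl⟩; exact (hR i).le) (convex_closedBall _ _)
    have h2 := interior_mono h1 hc
    rwa [interior_closedBall _ hR0.ne'] at h2
  have hα : ∀ k, 0 < (triBasis hb).coord k m := fun k => by
    by_contra! hk
    obtain ⟨i, j, hij, hik, hjk⟩ := exists_other_two k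
    obtain ⟨p, hp, hp1, hp2⟩ := exists_coord_eq_zero hb (hl k) hk
    exact absurd (h i j hij p (mem_openSegment_of_dist_lt hb hR hij hik hjk hp
      (hp2.trans_lt hcm))) (by linarith)
  have hE : ∀ k, R ≤ dist c (∑ l, b l - b k - m) := fun k => by
    obtain ⟨i, j, hij, hik, hjk⟩ := exists_other_two k
    rw [sum_fin_three hij hik hjk, show b i + (b j + b k) - b k - m = b i + b j - m by abel]
    by_contra! hk
    have hco : (triBasis hb).coord k (b i + b j - m) ≤ 0 := by
      have h1 := sum_coord_smul hb m
      have h2 := sum_coord hb m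
      set α : Fin 3 → ℝ := fun l => (triBasis hb).coord l m with hαd
      let μ : Fin 3 → ℝ := fun l => (if l = k then 0 else 1) - α l
      have h3 : ∑ l, μ l = 1 := by
        change ∑ l, α l = 1 at h2
        rw [sum_fin_three hij hik hjk] at h2 ⊢
        simp only [μ, hik, hjk, if_false, if_true]
        linarith
      have h4 : ∑ l, μ l • b l = b i + b j - m := by
        change ∑ l, α l • b l = m at h1
        rw [← h1, sum_fin_three hij hik hjk, sum_fin_three hij hik hjk]
        simp only [μ, hik, hjk, if_false, if_true]
        module
      rw [← h4, coord_sum_smul hb h3]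
      simp only [μ, if_true]
      have := hα k
      change 0 < α k at this
      linarith
    obtain ⟨p, hp, hp1, hp2⟩ := exists_coord_eq_zero hb (hl k) hco
    have hpm := dist_eq_dist_reflection hb hR hij hik hjk hp
    exact absurd (h i j hij p (mem_openSegment_of_dist_lt hb hR hij hik hjk hp
      (by linarith))) (by linarith)
  set d := c - (∑ l, b l - (2 : ℝ) • m) with hd
  have hk : ∀ k, 0 ≤ ‖d‖ ^ 2 + 2 * inner ℝ d (b k - m) := fun k => by
    have h1 := hE k
    rw [dist_eq_norm, show c - (∑ l, b l - b k - m) = d + (b k - m) by rw [hd]; module] at h1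
    have h2 := pow_le_pow_left₀ hR0.le h1 2
    rw [norm_add_sq_real, ← dist_eq_norm (b k) m, hR] at h2
    linarith
  set lam : Fin 3 → ℝ := fun l => (triBasis hb).coord l c
  have l1 : ∑ l, lam l = 1 := sum_coord hb c
  have l2 : ∑ l, lam l • b l = c := sum_coord_smul hb c
  have s1 : ∑ k, (1 - lam k) = 2 := by
    rw [Finset.sum_sub_distrib, l1]; norm_num
  have s2 : ∑ k, (1 - lam k) • (b k - m) = -d := by
    simp_rw [sub_smul, one_smul, smul_sub]
    rw [Finset.sum_sub_distrib, Finset.sum_sub_distrib, Finset.sum_sub_distrib, l2,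
      ← Finset.sum_smul, l1, hd]
    simp only [Finset.sum_const, Finset.card_univ, Fintype.card_fin]
    module
  have s3 : ∑ k, (1 - lam k) * (‖d‖ ^ 2 + 2 * inner ℝ d (b k - m)) = 0 := by
    have : ∀ k, (1 - lam k) * (‖d‖ ^ 2 + 2 * inner ℝ d (b k - m)) =
        (1 - lam k) * ‖d‖ ^ 2 + 2 * inner ℝ d ((1 - lam k) • (b k - m)) := fun k => by
      rw [inner_smul_right]; ring
    simp_rw [this]
    rw [Finset.sum_add_distrib, ← Finset.sum_mul, ← Finset.mul_sum, ← inner_sum, s1, s2,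
      inner_neg_right, real_inner_self_eq_norm_sq]
    ring
  have hlt : ∀ k, 0 < 1 - lam k := fun k => by
    obtain ⟨i, j, hij, hik, hjk⟩ := exists_other_two k
    rw [sum_fin_three hij hik hjk] at l1
    have := hl i
    have := hl j
    change 0 < lam i at *
    linarith
  have s4 := (Finset.sum_eq_zero_iff_of_nonneg fun k _ => mul_nonneg (hlt k).le (hk k)).1 s3
  have s5 : ∀ k, ‖d‖ ^ 2 + 2 * inner ℝ d (b k - m) = 0 := fun k =>
    (mul_eq_zero.1 (s4 k (Finset.mem_univ k))).resolve_left (hlt k).ne'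
  set α : Fin 3 → ℝ := fun l => (triBasis hb).coord l m
  have a1 : ∑ l, α l = 1 := sum_coord hb m
  have a2 : ∑ l, α l • (b l - m) = 0 := by
    simp_rw [smul_sub]
    rw [Finset.sum_sub_distrib, ← Finset.sum_smul, a1, one_smul]
    exact sub_eq_zero.2 (sum_coord_smul hb m)
  have s6 : ∑ k, α k * (‖d‖ ^ 2 + 2 * inner ℝ d (b k - m)) = ‖d‖ ^ 2 := by
    have : ∀ k, α k * (‖d‖ ^ 2 + 2 * inner ℝ d (b k - m)) =
        α k * ‖d‖ ^ 2 + 2 * inner ℝ d (α k • (b k - m)) := fun k => by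
      rw [inner_smul_right]; ring
    simp_rw [this]
    rw [Finset.sum_add_distrib, ← Finset.sum_mul, ← Finset.mul_sum, ← inner_sum, a1, a2,
      inner_zero_right]
    ring
  simp_rw [s5, mul_zero, Finset.sum_const_zero] at s6
  exact sub_eq_zero.1 (norm_eq_zero.1 (pow_eq_zero_iff two_ne_zero |>.1 s6.symm))

end
end Dom

namespace Dom

variable {W : Dom 2} {φ : W.X → Euc 2} {η : Fin 3 → W.X}

namespace Tri

theorem side_subset (h : Tri φ η) {i j : Fin 3} (hij : i ≠ j) :
    openSegment ℝ (W.π (η i)) (W.π (η j)) ⊆ W.carrier :=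
  (h.edge i j hij).sees_left.1

theorem side_notMem_interior_hull (h : Tri φ η) {i j : Fin 3} (hij : i ≠ j) {p : Euc 2}
    (hp : p ∈ openSegment ℝ (W.π (η i)) (W.π (η j))) : p ∉ interior (hull η) := by
  intro hI
  obtain ⟨k, hki, hkj⟩ : ∃ k, k ≠ i ∧ k ≠ j := by
    clear hp; revert i j; decide
  have h1 := (mem_interior_hull_iff h.indep p).1 hI k
  rw [openSegment_eq_image'] at hp
  obtain ⟨t, -, rfl⟩ := hp
  beta_reduce at h1
  have e1 : ∀ l, l ≠ k → (triBasis h.indep).coord k (W.π (η l)) = 0 := fun l hl =>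
    (triBasis h.indep).coord_apply_ne hl.symm
  rw [coord_add_smul_sub, e1 i hki.symm, e1 j hkj.symm] at h1
  simp at h1

theorem vertex_notMem_interior_hull (h : Tri φ η) (i : Fin 3) :
    W.π (η i) ∉ interior (hull η) := by
  intro hI
  obtain ⟨k, hk⟩ := exists_ne i
  have h1 := (mem_interior_hull_iff h.indep _).1 hI k
  have e1 : (triBasis h.indep).coord k (W.π (η i)) = 0 := (triBasis h.indep).coord_apply_ne hk
  linarith

theorem exists_dist_ext_le (h : Tri φ η) {c z : Euc 2} (hc : c ∉ W.carrier)
    (hW : openSegment ℝ z c ⊆ W.carrier) (hI : openSegment ℝ z c ⊆ interior (hull η)) :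
    ∃ θ, Bd θ ∧ W.π θ = c ∧ ∀ w ∈ openSegment ℝ z c, dist (W.ext φ w) (φ θ) ≤ dist w c := by
  obtain ⟨θ, hθ, hs⟩ := exists_sees (convex_openSegment z c) hW (e := c) (by
    rw [closure_openSegment]; exact right_mem_segment _ _ _)
  have hbd : Bd θ := bd_of_π_notMem (by rwa [hθ])
  refine ⟨θ, hbd, hθ, fun w hw => ?_⟩
  have hz : ∀ v ∈ openSegment ℝ z c, v ∈ W.zone (range fun i => W.π (η i)) (diam (hull η)) :=
    fun v hv => h.mem_zone (hW hv) (hI hv)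
  have hsub : openSegment ℝ w c ⊆ openSegment ℝ z c := by
    rw [openSegment_eq_image'] at hw
    obtain ⟨t, ht, rfl⟩ := hw
    rw [openSegment_eq_image', openSegment_eq_image']
    rintro _ ⟨s, hs, rfl⟩
    refine ⟨t + s * (1 - t), ⟨?_, ?_⟩, ?_⟩
    · have := mul_nonneg hs.1.le (sub_nonneg.2 ht.2.le)
      linarith [ht.1]
    · have := mul_lt_of_lt_one_left (sub_pos.2 ht.2) hs.2
      linarith
    · beta_reduce; module
  rw [← hθ]
  exact dist_ext_le_of_sees h.good hbd hs (hz w hw) (by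
    rw [hθ]; exact fun v hv => ⟨hz v (hsub hv), hsub hv⟩)

variable {m : Euc 2} {R : ℝ}

theorem le_dist_add_dist (h : Tri φ η) (hfar : ∀ ζ, Bd ζ → R ≤ dist (φ ζ) m) {c : Euc 2}
    (hcI : c ∈ interior (hull η)) (hc : c ∉ W.carrier) {i j : Fin 3} (hij : i ≠ j) {p : Euc 2}
    (hp : p ∈ openSegment ℝ (W.π (η i)) (W.π (η j))) : R ≤ dist p c + dist p m := by
  obtain ⟨e, he, hep, heW, hs⟩ := exists_first_exit (h.side_subset hij hp) hc
  have hpI : openSegment ℝ p c ⊆ interior (hull η) := by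
    rw [openSegment_symm]; exact openSegment_subset_interior_hull hcI (mem_hull_of_side hp)
  have heI : e ∈ interior (hull η) := by
    by_cases hec : e = c
    · rwa [hec]
    · exact hpI (mem_openSegment_of_ne_left_right hep.symm (Ne.symm hec) he)
  have hsI : openSegment ℝ p e ⊆ interior (hull η) := by
    rw [openSegment_symm]; exact openSegment_subset_interior_hull heI (mem_hull_of_side hp)
  obtain ⟨θ, hθ, -, hd⟩ := h.exists_dist_ext_le heW hs hsI
  obtain ⟨w, hw⟩ : (openSegment ℝ p e).Nonempty := ⟨_, midpoint_mem_openSegment p e⟩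
  have hws : openSegment ℝ w p ⊆ W.carrier := by
    rw [openSegment_symm]
    exact (openSegment_subset_segment ℝ p w).trans ((segment_subset_insert_openSegment p e hw).trans
      (insert_subset (h.side_subset hij hp) hs))
  have h1 := h.dist_ext_side_le hij hp (hsI hw) (hs hw) hws
  have h2 := hd w hw
  have h3 := hfar θ hθ
  have h4 := dist_add_dist_of_mem_segment (openSegment_subset_segment ℝ p e hw)
  have h5 := dist_add_dist_of_mem_segment he
  have h6 : 0 ≤ dist e c := dist_nonneg
  rw [dist_comm] at h1
  linarith [dist_triangle (φ θ) (W.ext φ w) m, dist_triangle (W.ext φ w) p m,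
    dist_comm (φ θ) (W.ext φ w), dist_triangle4 (φ θ) (W.ext φ w) p m, dist_comm p w,
    dist_comm p (W.ext φ w)]

theorem exists_dist_le (h : Tri φ η) {q : Euc 2} (hq : q ∈ interior (hull η))
    (hqW : q ∉ W.carrier) (huniq : ∀ c ∈ interior (hull η), c ∉ W.carrier → c = q) :
    ∃ θ, Bd θ ∧ ∀ i, dist (φ θ) (W.π (η i)) ≤ dist q (W.π (η i)) := by
  set x := W.π (η 0) with hx
  have hqx : q ≠ x := fun e => h.vertex_notMem_interior_hull 0 (by rwa [← hx, ← e])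
  obtain ⟨ε, hε0, hz⟩ : ∃ ε : ℝ, 0 < ε ∧ q + ε • (q - x) ∈ interior (hull η) := by
    have h1 : ContinuousAt (fun ε : ℝ => q + ε • (q - x)) 0 := by fun_prop
    have h2 := h1.preimage_mem_nhds (isOpen_interior.mem_nhds (by simpa using hq))
    obtain ⟨ε, h3, h4⟩ := Filter.nonempty_of_mem
      (inter_mem (nhdsWithin_le_nhds (s := Ioi (0 : ℝ)) h2) self_mem_nhdsWithin)
    exact ⟨ε, h4, h3⟩
  set z := q + ε • (q - x) with hzd
  have hmem : ∀ v ∈ openSegment ℝ z q, ∃ t : ℝ, 0 < t ∧ v = q + t • (q - x) := fun v hv => by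
    rw [openSegment_symm, openSegment_eq_image'] at hv
    obtain ⟨t, ht, rfl⟩ := hv
    exact ⟨t * ε, mul_pos ht.1 hε0, by rw [hzd]; module⟩
  have hI : openSegment ℝ z q ⊆ interior (hull η) :=
    (convex_convexHull ℝ _).interior.openSegment_subset hz hq
  have hsub : ∀ v ∈ interior (hull η), v ≠ q → v ∈ W.carrier := fun v hv hvq => by
    by_contra hvW; exact hvq (huniq v hv hvW)
  have hW : openSegment ℝ z q ⊆ W.carrier := fun v hv => hsub v (hI hv) fun e => by
    obtain ⟨t, ht, hv⟩ := hmem v hv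
    rw [e, left_eq_add, smul_eq_zero, sub_eq_zero] at hv
    exact hv.elim ht.ne' hqx
  obtain ⟨θ, hθ, -, hd⟩ := h.exists_dist_ext_le hqW hW hI
  obtain ⟨s, hsm, hlim⟩ := mem_closure_iff_seq_limit.1
    (show q ∈ closure (openSegment ℝ z q) by
      rw [closure_openSegment]; exact right_mem_segment _ _ _)
  have key : ∀ i j, i ≠ j → ∀ p ∈ openSegment ℝ (W.π (η i)) (W.π (η j)),
      dist (φ θ) p ≤ dist q p := fun i j hij p hp => by
    have h1 : ∀ k, dist (φ θ) p ≤ dist (s k) q + dist (s k) p := fun k => by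
      have h2 : openSegment ℝ (s k) p ⊆ interior (hull η) :=
        openSegment_subset_interior_hull (hI (hsm k)) (mem_hull_of_side hp)
      have h3 : openSegment ℝ (s k) p ⊆ W.carrier := fun v hv => hsub v (h2 hv) fun e => by
        obtain ⟨t, ht, hst⟩ := hmem _ (hsm k)
        rw [e, openSegment_eq_image'] at hv
        obtain ⟨u, hu, hq'⟩ := hv
        obtain ⟨τ, hτ, rfl⟩ : ∃ τ : ℝ, 0 < τ ∧ p = q + τ • (x - q) := by
          refine ⟨(1 - u) * t / u, div_pos (mul_pos (sub_pos.2 hu.2) ht) hu.1, ?_⟩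
          have e1 : u • (p - q) = ((1 - u) * t) • (x - q) := by
            rw [hst] at hq'
            rw [← sub_eq_zero] at hq' ⊢
            rw [← hq']
            module
          rw [div_eq_inv_mul, mul_smul, ← e1, inv_smul_smul₀ hu.1.ne']
          abel
        rcases lt_trichotomy τ 1 with h1 | rfl | h1
        · refine h.side_notMem_interior_hull hij hp
            (openSegment_subset_interior_hull hq (π_mem_hull η 0) ?_)
          rw [openSegment_eq_image']
          exact ⟨τ, ⟨hτ, h1⟩, rfl⟩
        · refine (h.bd 0).π_notMem ?_
          rw [one_smul, add_sub_cancel] at hp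
          exact h.side_subset hij hp
        · refine h.vertex_notMem_interior_hull 0
            (openSegment_subset_interior_hull hq (mem_hull_of_side hp) ?_)
          rw [openSegment_eq_image']
          refine ⟨τ⁻¹, ⟨inv_pos.2 hτ, inv_lt_one_of_one_lt₀ h1⟩, ?_⟩
          beta_reduce
          rw [add_sub_cancel_left, inv_smul_smul₀ hτ.ne', add_sub_cancel]
      have h4 := h.dist_ext_side_le hij hp (hI (hsm k)) (hW (hsm k)) h3
      have h5 := hd _ (hsm k)
      linarith [dist_triangle_left (φ θ) p (W.ext φ (s k))]
    have h6 : Tendsto (fun k => dist (s k) q + dist (s k) p) atTop (nhds (dist q q + dist q p)) :=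
      (hlim.dist tendsto_const_nhds).add (hlim.dist tendsto_const_nhds)
    rw [dist_self, zero_add] at h6
    exact ge_of_tendsto' h6 h1
  refine ⟨θ, hθ, fun i => ?_⟩
  obtain ⟨j, hj⟩ := exists_ne i
  have hcl : IsClosed {p | dist (φ θ) p ≤ dist q p} :=
    isClosed_le (by fun_prop) (by fun_prop)
  exact hcl.closure_subset_iff.2 (key i j hj.symm) (by
    rw [closure_openSegment]; exact left_mem_segment _ _ _)

/-- If `φ` maps no boundary element into the circumscribed disk, the interior of the triangle
lies in the domain. -/
theorem interior_hull_subset (h : Tri φ η) (hR0 : 0 < R) (hR : ∀ i, dist (W.π (η i)) m = R)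
    (hfar : ∀ ζ, Bd ζ → R ≤ dist (φ ζ) m) : interior (hull η) ⊆ W.carrier := by
  intro q hq
  by_contra hqW
  have hc : ∀ c ∈ interior (hull η), c ∉ W.carrier →
      c = ∑ i, W.π (η i) - (2 : ℝ) • m := fun c hc hcW =>
    eq_orthocenter h.indep hR0 hR hc fun i j hij p hp => h.le_dist_add_dist hfar hc hcW hij hp
  obtain ⟨θ, hθ, hd⟩ := h.exists_dist_le hq hqW fun c hcI hcW =>
    (hc c hcI hcW).trans (hc q hq hqW).symm
  have hl := (mem_interior_hull_iff h.indep q).1 hq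
  have e1 := sum_coord_smul h.indep q
  have h1 := eq_sum_smul_of_dist_le (fun i => (hl i).le) (sum_coord h.indep q)
    (fun _ _ => rfl) (x := φ θ) fun i => by rw [e1]; exact hd i
  rw [e1] at h1
  have h2 : hull η ⊆ closedBall m R :=
    convexHull_min (by rintro _ ⟨i, rfl⟩; exact (hR i).le) (convex_closedBall _ _)
  have h3 := interior_mono h2 hq
  rw [interior_closedBall _ hR0.ne', mem_ball, ← h1] at h3
  exact absurd h3 (not_lt.2 (hfar θ hθ))

end Tri
end Dom

namespace Dom

theorem BdIso.good {n : ℕ} {U V : Dom n} (f : BdIso U V) : Good fun ξ => V.π (f.F ξ) where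
  lip _ _ hξ hζ := (dist_π_le _ _).trans_eq (f.F_dist hξ hζ)
  edge _ _ h := h.map_dist f

theorem Good.comp_isometry {n : ℕ} {W : Dom n} {φ : W.X → Euc n} (h : Good φ)
    {J : Euc n → Euc n} (hJ : Isometry J) : Good fun ξ => J (φ ξ) where
  lip ξ ζ hξ hζ := (hJ.dist_eq _ _).trans_le (h.lip ξ ζ hξ hζ)
  edge ξ ζ hE := (hJ.dist_eq _ _).trans (h.edge ξ ζ hE)

variable {U V : Dom 2} (f : BdIso U V)

theorem dist_map_eq {I : Type*} {a : I → U.X} (hE : ∀ i j, i ≠ j → Edge (a i) (a j)) (i j : I) :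
    dist (U.π (a i)) (U.π (a j)) = dist (V.π (f.F (a i))) (V.π (f.F (a j))) := by
  by_cases hij : i = j
  · rw [hij, dist_self, dist_self]
  · exact ((hE i j hij).map_dist f).symm

theorem val_mem {w : Euc 2} (hw : w ∈ U.carrier) (c : Cell U w) :
    c.val (fun ξ => V.π (f.F ξ)) ∈ V.carrier := by
  have hcard : Fintype.card c.I ≤ 3 := by
    have h1 := c.indep.card_le_finrank_succ
    have h2 := Submodule.finrank_le (vectorSpan ℝ (range fun i => U.π (c.ξ i)))
    rw [finrank_euclideanSpace_fin] at h2
    omega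
  obtain ⟨k, e, hk⟩ : ∃ k, ∃ _ : Fin k ≃ c.I, k ≤ 3 :=
    ⟨_, (Fintype.equivFin c.I).symm, hcard⟩
  have h1 := c.sum_lam
  have h2 := c.sum_smul
  rw [← e.sum_comp] at h1 h2
  unfold Cell.val
  rw [← e.sum_comp]
  have hE : ∀ i j, i ≠ j → Edge (c.ξ (e i)) (c.ξ (e j)) := fun i j hij =>
    c.edge (e.injective.ne hij)
  have hpos : ∀ i, 0 < c.lam (e i) := fun i => c.lam_pos _
  interval_cases k
  · simp at h1
  · rw [Fin.sum_univ_one] at h1 h2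
    rw [h1, one_smul] at h2
    exact absurd (h2 ▸ hw) (c.bd _).π_notMem
  · rw [Fin.sum_univ_two] at h1 ⊢
    exact ((hE 0 1 (by decide)).map f).sees_left.1 ⟨_, _, hpos 0, hpos 1, h1, rfl⟩
  · have hU := c.indep.comp_embedding e.toEmbedding
    have hd := dist_map_eq f hE
    have hV := affineIndependent_of_dist_eq hU hd
    obtain ⟨J, hJ⟩ := exists_affineIsometry hU hd
    have hT : Tri (fun ζ => J (U.π (f.G ζ))) (fun i => f.F (c.ξ (e i))) :=
      { good := f.symm.good.comp_isometry J.isometry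
        edge := fun i j hij => (hE i j hij).map f
        indep := hV
        fixed := fun i => by
          rw [f.GF (c.bd _)]; exact hJ i }
    refine hT.interior_hull_subset (m := J c.m) c.R_pos (fun i => ?_) (fun ζ hζ => ?_) ?_
    · rw [← c.dist_m (e i), ← J.dist_map (U.π (c.ξ (e i)))]
      exact congrArg (dist · _) (hJ i).symm
    · rw [J.dist_map]
      by_contra! hlt
      exact (f.G_bd hζ).π_notMem (c.ball_subset hlt)
    · refine (mem_interior_hull_iff hV _).2 fun i => ?_
      rw [coord_sum_smul hV h1]
      exact hpos i

/-- A boundary isometry carries the interior of a boundary triangle into the target domain. -/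
theorem interior_hull_map_subset {a : Fin 3 → U.X} (hE : ∀ i j, i ≠ j → Edge (a i) (a j))
    (hU : AffineIndependent ℝ fun i => U.π (a i)) (hs : ∀ i, Sees (interior (hull a)) (a i)) :
    interior (hull fun i => f.F (a i)) ⊆ V.carrier := by
  intro q hq
  have hd := dist_map_eq f hE
  have hV := affineIndependent_of_dist_eq hU hd
  have hl := (mem_interior_hull_iff hV q).1 hq
  set lam : Fin 3 → ℝ := fun i => (triBasis hV).coord i q
  have h1 : ∑ i, lam i = 1 := sum_coord hV q
  have h2 : ∑ i, lam i • V.π (f.F (a i)) = q := sum_coord_smul hV q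
  set w := ∑ i, lam i • U.π (a i) with hw
  have hwI : w ∈ interior (hull a) := (mem_interior_hull_iff hU w).2 fun i => by
    rw [hw, coord_sum_smul hU h1]; exact hl i
  have hbd : ∀ i, Bd (a i) := fun i => by
    obtain ⟨j, hj⟩ := exists_ne i
    exact (hE i j hj.symm).bd_left
  have hz : ∀ v ∈ interior (hull a), v ∈ U.zone (range fun i => U.π (a i)) (diam (hull a)) :=
    fun v hv => mem_zone (fun i => (hbd i).π_notMem) ((hs 0).1 hv) hv
  have hext := eq_sum_smul_of_dist_le (fun i => (hl i).le) h1 hd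
    (x := U.ext (fun ξ => V.π (f.F ξ)) w) fun i => by
      refine dist_ext_le_of_sees f.good (hbd i) (hs i) (hz w hwI) fun v hv => ?_
      have := openSegment_subset_interior_hull hwI (π_mem_hull a i) hv
      exact ⟨hz v this, this⟩
  obtain ⟨hwU, r, hr⟩ := hz w hwI
  obtain ⟨c⟩ := hr.nonempty_cell hwU
  rw [h2, ext_eq f.good c] at hext
  rw [← hext]
  exact val_mem f hwU c

end Dom

namespace Dom

theorem sees_pt {n : ℕ} {W : Dom n} {C : Set (Euc n)} (hC : Convex ℝ C) (hCW : C ⊆ W.carrier)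
    {s : HBSeq W.carrier} (hs : ∀ k, s.seq k ∈ C) {e : Euc n}
    (hlim : Tendsto s.seq atTop (nhds e)) :
    W.π (pt (Quot.mk (HBEquiv W.carrier) s)) = e ∧ Sees C (pt (Quot.mk (HBEquiv W.carrier) s)) := by
  obtain ⟨ξ, hξ, h⟩ := exists_sees hC hCW
    (mem_closure_of_tendsto hlim (Eventually.of_forall hs))
  have h1 : Tendsto (fun k => W.ι (s.seq k)) atTop (nhds ξ) := by
    rw [tendsto_iff_dist_tendsto_zero]
    refine squeeze_zero (fun _ => dist_nonneg) (fun k => h.2 _ (hs k)) ?_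
    rw [hξ]
    exact tendsto_iff_dist_tendsto_zero.1 hlim
  rw [tendsto_nhds_unique (tendsto_pt s) h1]
  exact ⟨hξ, h⟩

/-- The triangle without its vertices. -/
def punctured {b : Fin 3 → Euc 2} (hb : AffineIndependent ℝ b) : Set (Euc 2) :=
  {p | ∀ i, (triBasis hb).coord i p ∈ Ico (0 : ℝ) 1}

section
variable {b : Fin 3 → Euc 2} (hb : AffineIndependent ℝ b)

theorem convex_punctured : Convex ℝ (punctured hb) := by
  have : punctured hb = ⋂ i, (triBasis hb).coord i ⁻¹' Ico (0 : ℝ) 1 := by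
    ext p; simp [punctured]
  rw [this]
  exact convex_iInter fun i => (convex_Ico 0 1).affine_preimage _

theorem punctured_subset : punctured hb ⊆ convexHull ℝ (range b) \ range b := by
  refine fun p hp => ⟨(mem_hull_iff hb p).2 fun i => (hp i).1, ?_⟩
  rintro ⟨i, rfl⟩
  exact (hp i).2.ne ((triBasis hb).coord_apply_eq i)

theorem openSegment_subset_punctured {i j : Fin 3} (hij : i ≠ j) :
    openSegment ℝ (b i) (b j) ⊆ punctured hb := by
  rw [openSegment_eq_image']
  rintro _ ⟨t, ht, rfl⟩ k
  have e : ∀ l, (triBasis hb).coord k (b l) = if k = l then 1 else 0 :=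
    (triBasis hb).coord_apply k
  beta_reduce
  rw [coord_add_smul_sub, e, e]
  by_cases hi : k = i
  · rw [if_pos hi, if_neg (hi ▸ hij)]
    exact ⟨by linarith [ht.2], by linarith [ht.1]⟩
  · rw [if_neg hi]
    split_ifs
    · exact ⟨by linarith [ht.1], by linarith [ht.2]⟩
    · simp

theorem interior_hull_subset_punctured : interior (convexHull ℝ (range b)) ⊆ punctured hb := by
  intro p hp k
  have h := (mem_interior_hull_iff hb p).1 hp
  have h1 := sum_coord hb p
  obtain ⟨i, j, hij, hik, hjk⟩ := exists_other_two k
  rw [sum_fin_three hij hik hjk] at h1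
  exact ⟨(h k).le, by linarith [h i, h j]⟩

theorem mem_interior_or_mem_openSegment (hb : AffineIndependent ℝ b)
    {q : Euc 2} (hq : q ∈ convexHull ℝ (range b))
    (hq' : q ∉ range b) : q ∈ interior (convexHull ℝ (range b)) ∨
      ∃ i j, i ≠ j ∧ q ∈ openSegment ℝ (b i) (b j) := by
  have h := (mem_hull_iff hb q).1 hq
  by_cases hk : ∃ k, (triBasis hb).coord k q = 0
  · obtain ⟨k, hk⟩ := hk
    right
    obtain ⟨i, j, hij, hik, hjk⟩ := exists_other_two k
    have h1 := sum_coord hb q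
    have h2 := sum_coord_smul hb q
    rw [sum_fin_three hij hik hjk, hk, add_zero] at h1
    rw [sum_fin_three hij hik hjk, hk, zero_smul, add_zero] at h2
    refine ⟨i, j, hij, mem_openSegment_of_coord hb hij hik hjk hk
      ((h i).lt_of_ne fun e => hq' ⟨j, ?_⟩)
      ((h j).lt_of_ne fun e => hq' ⟨i, ?_⟩)⟩
    · rw [← e, zero_add] at h1
      rw [← h2, ← e, h1, zero_smul, one_smul, zero_add]
    · rw [← e, add_zero] at h1
      rw [← h2, ← e, h1, zero_smul, one_smul, add_zero]
  · push Not at hk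
    exact .inl ((mem_interior_hull_iff hb q).2 fun i => (h i).lt_of_ne (hk i).symm)

end

theorem triangle_map {U V : Dom 2} (f : BdIso U V) {b : Fin 3 → Euc 2}
    (hb : AffineIndependent ℝ b) (hΔ : convexHull ℝ (range b) \ range b ⊆ U.carrier)
    {t : Fin 3 → HausdorffBoundary U.carrier}
    (ht : ∀ i, ∃ j, i ≠ j ∧ GeneratesEndpoint U.carrier (b i) (b j) (t i)) :
    (∀ i j, dist (V.π (f.F (pt (t i)))) (V.π (f.F (pt (t j)))) = dist (b i) (b j)) ∧
      AffineIndependent ℝ (fun i => V.π (f.F (pt (t i)))) ∧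
      convexHull ℝ (range fun i => V.π (f.F (pt (t i)))) \ (range fun i => V.π (f.F (pt (t i)))) ⊆
        V.carrier := by
  have hC : punctured hb ⊆ U.carrier := (punctured_subset hb).trans hΔ
  have hs : ∀ i, U.π (pt (t i)) = b i ∧ Sees (punctured hb) (pt (t i)) := fun i => by
    obtain ⟨j, hij, s, hst, hseg, hlim⟩ := ht i
    rw [← hst]
    exact sees_pt (convex_punctured hb) hC
      (fun k => openSegment_subset_punctured hb hij (hseg k)) hlim
  obtain rfl : (fun i => U.π (pt (t i))) = b := funext fun i => (hs i).1
  have hE : ∀ i j, i ≠ j → Edge (pt (t i)) (pt (t j)) := fun i j hij =>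
    have h := openSegment_subset_punctured hb hij
    ⟨bd_pt _, bd_pt _, hb.injective.ne hij, (hs i).2.mono h, (hs j).2.mono h⟩
  have hd := dist_map_eq f hE
  have hV := affineIndependent_of_dist_eq hb hd
  refine ⟨fun i j => (hd i j).symm, hV, fun q hq => ?_⟩
  rcases mem_interior_or_mem_openSegment hV hq.1 hq.2 with h | ⟨i, j, hij, h⟩
  · exact interior_hull_map_subset f hE hb
      (fun i => (hs i).2.mono (interior_hull_subset_punctured hb)) h
  · exact ((hE i j hij).map f).sees_left.1 h

end Dom

/-- Lemma 2.7: an isometry of Hausdorff boundaries in the relative metrics takes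
boundary triangles into equal boundary triangles. -/
theorem boundary_triangle_invariance
    (U V : Set (Euc 2))
    (hU : IsEucDomain U) (hV : IsEucDomain V) (hU' : U ≠ univ) (hV' : V ≠ univ)
    (f : HausdorffBoundary U → HausdorffBoundary V) (hf : IsHBIsometry f)
    (x y z : Euc 2) (hxyz : IsBoundaryTriangle U x y z)
    (xt yt zt : HausdorffBoundary U)
    (hxt : GeneratesEndpoint U x y xt) (hyt : GeneratesEndpoint U y z yt)
    (hzt : GeneratesEndpoint U z x zt) :
    IsBoundaryTriangle V (hbSupport (f xt)) (hbSupport (f yt)) (hbSupport (f zt)) ∧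
      dist (hbSupport (f xt)) (hbSupport (f yt)) = dist x y ∧
      dist (hbSupport (f zt)) (hbSupport (f yt)) = dist z y ∧
      dist (hbSupport (f xt)) (hbSupport (f zt)) = dist x z := by
  obtain ⟨F, hF⟩ := Dom.exists_bdIso (U := ⟨U, hU⟩) (V := ⟨V, hV⟩) f hf
  have hr : ∀ v : Fin 3 → Euc 2, range v = {v 0, v 1, v 2} := fun v => by
    ext p; simp [Fin.exists_fin_succ, eq_comm]
  obtain ⟨hd, hi, hs⟩ := Dom.triangle_map F (b := ![x, y, z])
    (affineIndependent_iff_not_collinear_set.2 hxyz.1) (by rw [hr]; exact hxyz.2.2.2.2)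
    (t := ![xt, yt, zt]) fun i => by
      fin_cases i
      · exact ⟨1, by decide, hxt⟩
      · exact ⟨2, by decide, hyt⟩
      · exact ⟨0, by decide, hzt⟩
  have hsup : ∀ a, hbSupport (f a) = (⟨V, hV⟩ : Dom 2).π (F.F (Dom.pt a)) := fun a => by
    rw [hF]; exact Dom.hbSupport_eq (W := ⟨V, hV⟩) (f a)
  have hfr : ∀ a, hbSupport (f a) ∈ frontier V := fun a => by
    rw [hsup]; exact (F.F_bd (Dom.bd_pt a)).π_mem_frontier
  simp_rw [← hsup] at hd hi hs
  rw [hr] at hs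
  refine ⟨⟨?_, hfr _, hfr _, hfr _, hs⟩, hd 0 1, hd 2 1, hd 0 2⟩
  rw [← affineIndependent_iff_not_collinear_set]
  have e : ![hbSupport (f xt), hbSupport (f yt), hbSupport (f zt)] =
      fun i => hbSupport (f (![xt, yt, zt] i)) := by
    ext i : 1; fin_cases i <;> rfl
  rwa [e]
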